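/- arXiv:1310.6830 — 4 statements merged into one kernel-verified Lean document; each statement's English description precedes it below -/
import Mathlib

section
/- Let n ≥ 3 and let m_1, …, m_{n-1} be positive integers. Then the multipliers of n−1 distinct periodic orbits of periods m_1, …, m_{n-1}, considered as (multiple-valued) algebraic functions on 𝒫^n, satisfy no nonzero polynomial relation over ℂ. Concretely: for every nonzero polynomial P ∈ ℂ[X_1, …, X_{n-1}] there exist a monic centered polynomial p of degree n and periodic points z_1, …, z_{n-1} of p of respective minimal periods m_1, …, m_{n-1}, lying in pairwise distinct periodic orbits, each with multiplier ≠ 1, such that P(λ_1, …, λ_{n-1}) ≠ 0, where λ_j = (p^{∘m_j})'(z_j) is the multiplier of the orbit of z_j. -/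
open Function Filter Topology Finset

/-- Simple roots `b k` of `q` continue to solutions of the system `q (z k) = s * z (σ k)` for
small `s`. -/
theorem exists_tendsto_eval_eq_mul {ι : Type*} [Fintype ι] (q : Polynomial ℂ) (σ : ι → ι)
    (b : ι → ℂ) (hb : ∀ k, q.eval (b k) = 0) (hb' : ∀ k, q.derivative.eval (b k) ≠ 0) :
    ∃ z : ℂ → ι → ℂ, Tendsto z (𝓝 0) (𝓝 b) ∧
      ∀ᶠ s in 𝓝 0, ∀ k, q.eval (z s k) = s * z s (σ k) := by
  classical
  let f : ℂ × (ι → ℂ) → ι → ℂ := fun v k => q.eval (v.2 k) - v.1 * v.2 (σ k)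
  let pr (k : ι) : ℂ × (ι → ℂ) →L[ℂ] ℂ :=
    (ContinuousLinearMap.proj k).comp (ContinuousLinearMap.snd ℂ ℂ (ι → ℂ))
  let f' : ℂ × (ι → ℂ) →L[ℂ] ι → ℂ := ContinuousLinearMap.pi fun k =>
    q.derivative.eval (b k) • pr k
      - ((0 : ℂ) • pr (σ k) + b (σ k) • ContinuousLinearMap.fst ℂ ℂ (ι → ℂ))
  have hf : HasStrictFDerivAt f f' ((0 : ℂ), b) := by
    rw [hasStrictFDerivAt_pi]
    intro k
    have hp : ∀ k, HasStrictFDerivAt (fun v : ℂ × (ι → ℂ) => v.2 k) (pr k) ((0 : ℂ), b) :=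
      fun k => (pr k).hasStrictFDerivAt
    have h1 := (q.hasStrictDerivAt (b k)).comp_hasStrictFDerivAt ((0 : ℂ), b) (hp k)
    have h2 := (ContinuousLinearMap.fst ℂ ℂ (ι → ℂ)).hasStrictFDerivAt (x := ((0 : ℂ), b))
    exact h1.sub (h2.mul (hp (σ k)))
  have hinv : (f' ∘L ContinuousLinearMap.inr ℂ ℂ (ι → ℂ)).IsInvertible := by
    refine ⟨ContinuousLinearEquiv.piCongrRight fun k =>
      ContinuousLinearEquiv.unitsEquivAut ℂ (Units.mk0 _ (hb' k)), ?_⟩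
    ext v k
    simp [f', pr, mul_comm]
  refine ⟨hf.implicitFunctionOfProdDomain hinv, hf.tendsto_implicitFunctionOfProdDomain hinv, ?_⟩
  filter_upwards [hf.eventually_apply_implicitFunctionOfProdDomain hinv] with s hs k
  have := congrFun hs k
  simp only [f, hb, zero_mul, sub_zero] at this
  exact sub_eq_zero.mp this

theorem hasDerivAt_eval_iterate (p : Polynomial ℂ) (x : ℂ) (k : ℕ) :
    HasDerivAt (fun w => p.eval w)^[k]
      (∏ i ∈ range k, p.derivative.eval ((fun w => p.eval w)^[i] x)) x := by
  induction k with
  | zero => simpa using hasDerivAt_id x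
  | succ k ih =>
    rw [iterate_succ', prod_range_succ, mul_comm]
    exact (p.hasDerivAt _).comp x ih

/-- Under the substitution `X j = s⁻¹ ^ m j * μ j` with `s → 0`, the top weighted homogeneous
component of `P` dominates. -/
theorem tendsto_eval_weighted {σ α : Type*} [Fintype σ] (m : σ → ℕ) (P : MvPolynomial σ ℂ)
    {l : Filter α} {s : α → ℂ} (hs : Tendsto s l (𝓝 0)) (hs0 : ∀ᶠ x in l, s x ≠ 0)
    {μ : α → σ → ℂ} {W : σ → ℂ} (hμ : Tendsto μ l (𝓝 W)) :
    Tendsto (fun x => s x ^ P.weightedTotalDegree m *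
        MvPolynomial.eval (fun j => (s x)⁻¹ ^ m j * μ x j) P) l
      (𝓝 (MvPolynomial.eval W
        (MvPolynomial.weightedHomogeneousComponent m (P.weightedTotalDegree m) P))) := by
  classical
  set D := P.weightedTotalDegree m
  have hlim : Tendsto (fun x => ∑ d ∈ P.support, P.coeff d *
      (s x ^ (D - Finsupp.weight m d) * ∏ i, μ x i ^ d i)) l
      (𝓝 (∑ d ∈ P.support, P.coeff d *
        (0 ^ (D - Finsupp.weight m d) * ∏ i, W i ^ d i))) :=
    tendsto_finsetSum _ fun d _ => ((hs.pow _).mul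
      (tendsto_finsetProd _ fun i _ => ((tendsto_pi_nhds.1 hμ i).pow _))).const_mul _
  have heq : MvPolynomial.eval W (MvPolynomial.weightedHomogeneousComponent m D P) =
      ∑ d ∈ P.support, P.coeff d * (0 ^ (D - Finsupp.weight m d) * ∏ i, W i ^ d i) := by
    rw [MvPolynomial.weightedHomogeneousComponent_apply, map_sum, sum_filter]
    refine sum_congr rfl fun d hd => ?_
    have hle : Finsupp.weight m d ≤ D := MvPolynomial.le_weightedTotalDegree m hd
    split_ifs with h
    · simp [h, MvPolynomial.eval_monomial, Finsupp.prod_fintype]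
    · rw [zero_pow (by omega)]; simp
  rw [heq]
  refine hlim.congr' ?_
  filter_upwards [hs0] with x hx
  rw [MvPolynomial.eval_eq', mul_sum]
  refine sum_congr rfl fun d hd => ?_
  have hle : Finsupp.weight m d ≤ D := MvPolynomial.le_weightedTotalDegree m hd
  have hprod : ∏ i, ((s x)⁻¹ ^ m i * μ x i) ^ d i =
      (s x)⁻¹ ^ Finsupp.weight m d * ∏ i, μ x i ^ d i := by
    simp_rw [mul_pow, prod_mul_distrib, ← pow_mul, prod_pow_eq_pow_sum]
    congr 2
    rw [Finsupp.weight_apply, Finsupp.sum_fintype _ _ (by simp)]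
    simp [mul_comm]
  rw [hprod, pow_sub₀ _ hx hle, inv_pow]
  ring

theorem eval_weighted_smul {σ : Type*} [Fintype σ] (m : σ → ℕ) (Q : MvPolynomial σ ℂ) {D : ℕ}
    (hQ : Q.IsWeightedHomogeneous m D) (t : ℂ) (W : σ → ℂ) :
    MvPolynomial.eval (fun j => t ^ m j * W j) Q = t ^ D * MvPolynomial.eval W Q := by
  rw [MvPolynomial.eval_eq', MvPolynomial.eval_eq', mul_sum]
  refine sum_congr rfl fun d hd => ?_
  rw [← hQ (MvPolynomial.mem_support_iff.1 hd), Finsupp.weight_apply,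
    Finsupp.sum_fintype _ _ (by simp)]
  simp_rw [mul_pow, prod_mul_distrib, ← pow_mul, prod_pow_eq_pow_sum, smul_eq_mul]
  simp_rw [mul_comm (m _)]
  ring

/-- If the first variable tends to infinity while the others converge to a point where the
leading coefficient of `P` does not vanish, then `P` is eventually nonzero. -/
theorem eventually_eval_cons_ne_zero {α : Type*} {N : ℕ} {P : MvPolynomial (Fin (N + 1)) ℂ}
    {l : Filter α} {x : α → Fin N → ℂ} {x₀ : Fin N → ℂ} (hx : Tendsto x l (𝓝 x₀)) {y : α → ℂ}
    (hy : Tendsto (fun u => (y u)⁻¹) l (𝓝 0)) (hy0 : ∀ᶠ u in l, y u ≠ 0)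
    (hP : MvPolynomial.eval x₀ (MvPolynomial.finSuccEquiv ℂ N P).leadingCoeff ≠ 0) :
    ∀ᶠ u in l, MvPolynomial.eval (Fin.cons (y u) (x u) : Fin (N + 1) → ℂ) P ≠ 0 := by
  set F := MvPolynomial.finSuccEquiv ℂ N P
  have hlim : Tendsto (fun u => ∑ i ∈ range (F.natDegree + 1),
      MvPolynomial.eval (x u) (F.coeff i) * (y u)⁻¹ ^ (F.natDegree - i)) l
      (𝓝 (∑ i ∈ range (F.natDegree + 1),
        MvPolynomial.eval x₀ (F.coeff i) * 0 ^ (F.natDegree - i))) :=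
    tendsto_finsetSum _ fun i _ =>
      (((MvPolynomial.continuous_eval (F.coeff i)).tendsto x₀).comp hx).mul (hy.pow _)
  rw [sum_range_succ, sum_eq_zero, zero_add, Nat.sub_self, pow_zero, mul_one] at hlim
  · filter_upwards [hlim.eventually_ne hP, hy0] with u hu hyu h0
    refine hu ?_
    rw [MvPolynomial.eval_eq_eval_mv_eval', Polynomial.eval_eq_sum_range' (n := F.natDegree + 1)
      (Nat.lt_succ_of_le Polynomial.natDegree_map_le)] at h0
    rw [← mul_zero ((y u)⁻¹ ^ F.natDegree), ← h0, mul_sum]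
    refine sum_congr rfl fun i hi => ?_
    rw [pow_sub₀ _ (inv_ne_zero hyu) (Nat.lt_succ_iff.1 (mem_range.1 hi)), Polynomial.coeff_map]
    simp
    ring
  · intro i hi
    rw [zero_pow (Nat.sub_ne_zero_of_lt (mem_range.1 hi)), mul_zero]

/-- The derivative of the monic polynomial with roots `a` at the root `a i`. -/
noncomputable def rootDeriv {k : ℕ} (a : Fin k → ℂ) (i : Fin k) : ℂ :=
  (Lagrange.nodal univ a).derivative.eval (a i)

theorem rootDeriv_eq_prod {k : ℕ} (a : Fin k → ℂ) (i : Fin k) :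
    rootDeriv a i = ∏ j ∈ univ.erase i, (a i - a j) := by
  rw [rootDeriv, Lagrange.eval_nodal_derivative_eval_node_eq (mem_univ i), Lagrange.eval_nodal]

theorem rootDeriv_ne_zero {k : ℕ} {a : Fin k → ℂ} (ha : Injective a) (i : Fin k) :
    rootDeriv a i ≠ 0 := by
  rw [rootDeriv_eq_prod, prod_ne_zero_iff]
  exact fun j hj => sub_ne_zero.2 fun h => (mem_erase.1 hj).1 (ha h).symm

theorem rootDeriv_sub_const {k : ℕ} (a : Fin k → ℂ) (c : ℂ) (i : Fin k) :
    rootDeriv (fun j => a j - c) i = rootDeriv a i := by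
  simp [rootDeriv_eq_prod]

theorem nodal_cons {k : ℕ} (a : Fin k → ℂ) (A : ℂ) :
    Lagrange.nodal univ (Fin.cons A a : Fin (k + 1) → ℂ) =
      (Polynomial.X - Polynomial.C A) * Lagrange.nodal univ a := by
  simp [Lagrange.nodal_eq, Fin.prod_univ_succ]

theorem rootDeriv_cons_zero {k : ℕ} (a : Fin k → ℂ) (A : ℂ) :
    rootDeriv (Fin.cons A a : Fin (k + 1) → ℂ) 0 = ∏ i, (A - a i) := by
  simp [rootDeriv, nodal_cons, Polynomial.derivative_mul, Lagrange.eval_nodal]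

theorem rootDeriv_cons_succ {k : ℕ} (a : Fin k → ℂ) (A : ℂ) (i : Fin k) :
    rootDeriv (Fin.cons A a : Fin (k + 1) → ℂ) i.succ = (a i - A) * rootDeriv a i := by
  simp [rootDeriv, nodal_cons, Polynomial.derivative_mul,
    Lagrange.eval_nodal_at_node (mem_univ i)]

/-- The product of the derivatives of `t * ∏ (X - a i)` along the itinerary that visits the root
`a j` once and the root `a (j + 1)` `e j` times. -/
noncomputable def itineraryProd {N : ℕ} (e : Fin N → ℕ) (t : ℂ) (a : Fin (N + 1) → ℂ)
    (j : Fin N) : ℂ :=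
  t * rootDeriv a j.castSucc * (t * rootDeriv a j.succ) ^ e j

theorem itineraryProd_cons {N : ℕ} (e : Fin (N + 2) → ℕ) {t u : ℂ} (hu : u ≠ 0)
    (a : Fin (N + 2) → ℂ) :
    itineraryProd e (-t * u) (Fin.cons u⁻¹ a : Fin (N + 3) → ℂ) =
      (Fin.cons (-t * u * (∏ i, (u⁻¹ - a i)) *
          (t * (1 - u * a 0) * rootDeriv a 0) ^ e 0)
        (fun j : Fin (N + 1) => t * (1 - u * a j.castSucc) * rootDeriv a j.castSucc *
          (t * (1 - u * a j.succ) * rootDeriv a j.succ) ^ e j.succ) :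
        Fin (N + 2) → ℂ) := by
  have key (i : Fin (N + 2)) : -t * u * rootDeriv (Fin.cons u⁻¹ a : Fin (N + 3) → ℂ) i.succ =
      t * (1 - u * a i) * rootDeriv a i := by
    rw [rootDeriv_cons_succ]
    field_simp
    ring
  funext j
  refine Fin.cases ?_ (fun j => ?_) j
  · rw [itineraryProd, key, Fin.castSucc_zero, rootDeriv_cons_zero, Fin.cons_zero]
  · rw [itineraryProd, key, ← Fin.succ_castSucc, key, Fin.cons_succ]

/-- The products `itineraryProd e t a` are algebraically independent functions of `t` and `a`.
The induction adds a root `u⁻¹` tending to infinity, with `t` rescaled so that the products at the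
old roots converge. -/
theorem exists_eval_itineraryProd_ne_zero {N : ℕ} (e : Fin (N + 1) → ℕ)
    (P : MvPolynomial (Fin (N + 1)) ℂ) (hP : P ≠ 0) :
    ∃ (t : ℂ) (a : Fin (N + 2) → ℂ), Injective a ∧ t ≠ 0 ∧
      MvPolynomial.eval (itineraryProd e t a) P ≠ 0 := by
  have hlead {k : ℕ} {P : MvPolynomial (Fin (k + 1)) ℂ} (hP : P ≠ 0) :
      (MvPolynomial.finSuccEquiv ℂ k P).leadingCoeff ≠ 0 := by
    simpa using hP
  have hid : Tendsto (fun u : ℂ => u) (𝓝[≠] 0) (𝓝 0) :=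
    tendsto_nhdsWithin_of_tendsto_nhds tendsto_id
  induction N with
  | zero =>
    have hinj : Injective (![1, 0] : Fin 2 → ℂ) := by
      intro i j
      fin_cases i <;> fin_cases j <;> simp
    have hw0 : rootDeriv (![1, 0] : Fin 2 → ℂ) 0 = 1 := by
      rw [rootDeriv_eq_prod, show univ.erase (0 : Fin 2) = {1} by decide]; simp
    have hw1 : rootDeriv (![1, 0] : Fin 2 → ℂ) 1 = -1 := by
      rw [rootDeriv_eq_prod, show univ.erase (1 : Fin 2) = {0} by decide]; simp
    have hev := eventually_eval_cons_ne_zero (P := P) (l := 𝓝[≠] (0 : ℂ))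
      (x := fun _ => Fin.elim0) (x₀ := Fin.elim0) tendsto_const_nhds
      (y := fun u => u⁻¹ * (-u⁻¹) ^ e 0) ?_ ?_ ?_
    · obtain ⟨u, hu, hu0⟩ := (hev.and self_mem_nhdsWithin).exists
      refine ⟨u⁻¹, ![1, 0], hinj, inv_ne_zero hu0, ?_⟩
      convert hu using 3
      funext j
      rw [Fin.fin_one_eq_zero j, Fin.cons_zero, itineraryProd]
      change u⁻¹ * rootDeriv ![1, 0] 0 * (u⁻¹ * rootDeriv ![1, 0] 1) ^ e 0 = _
      rw [hw0, hw1]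
      simp
    · have : Tendsto (fun u : ℂ => u * (-u) ^ e 0) (𝓝[≠] 0) (𝓝 (0 * (-0) ^ e 0)) :=
        hid.mul (hid.neg.pow _)
      rw [zero_mul] at this
      refine this.congr fun u => ?_
      simp [← inv_neg, mul_comm]
    · filter_upwards [self_mem_nhdsWithin] with u hu
      have : u ≠ 0 := hu
      simp [this]
    · have h := hlead hP
      rw [MvPolynomial.eq_C_of_isEmpty (MvPolynomial.finSuccEquiv ℂ 0 P).leadingCoeff] at h ⊢
      rw [MvPolynomial.eval_C]
      exact fun h0 => h (by rw [h0, map_zero])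
  | succ N ih =>
    obtain ⟨t, a, ha, ht, hQ⟩ := ih (fun j => e j.succ) _ (hlead hP)
    have hfac (i : Fin (N + 2)) : Tendsto (fun u : ℂ => 1 - u * a i) (𝓝[≠] 0) (𝓝 1) := by
      simpa using (hid.mul_const (a i)).const_sub 1
    have hfac_ne : ∀ᶠ u : ℂ in 𝓝[≠] 0, ∀ i, 1 - u * a i ≠ 0 :=
      eventually_all.2 fun i => (hfac i).eventually_ne one_ne_zero
    have hgen (i : Fin (N + 2)) : Tendsto (fun u : ℂ => t * (1 - u * a i) * rootDeriv a i)
        (𝓝[≠] 0) (𝓝 (t * rootDeriv a i)) := by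
      simpa using ((hfac i).const_mul t).mul_const (rootDeriv a i)
    have hprod {u : ℂ} (hu : u ≠ 0) :
        ∏ i, (u⁻¹ - a i) = u⁻¹ ^ (N + 2) * ∏ i, (1 - u * a i) := by
      rw [← Fin.prod_const, ← prod_mul_distrib]
      refine prod_congr rfl fun i _ => ?_
      field_simp
    have hev := eventually_eval_cons_ne_zero (P := P) (l := 𝓝[≠] (0 : ℂ))
      (x := fun u (j : Fin (N + 1)) => t * (1 - u * a j.castSucc) * rootDeriv a j.castSucc *
          (t * (1 - u * a j.succ) * rootDeriv a j.succ) ^ e j.succ)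
      (tendsto_pi_nhds.2 fun j => (hgen j.castSucc).mul ((hgen j.succ).pow (e j.succ)))
      (y := fun u => -t * u * (∏ i, (u⁻¹ - a i)) * (t * (1 - u * a 0) * rootDeriv a 0) ^ e 0)
      ?_ ?_ hQ
    · obtain ⟨u, ⟨hu, hu'⟩, hu0⟩ := ((hev.and hfac_ne).and self_mem_nhdsWithin).exists
      have hu0 : u ≠ 0 := hu0
      refine ⟨-t * u, Fin.cons u⁻¹ a, Fin.cons_injective_iff.2 ⟨?_, ha⟩, by simp [ht, hu0], ?_⟩
      · rintro ⟨i, hi⟩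
        exact hu' i (by rw [hi, mul_inv_cancel₀ hu0, sub_self])
      · rwa [itineraryProd_cons e hu0]
    · have hlim : Tendsto (fun u : ℂ => (-t)⁻¹ * u ^ (N + 1) * (∏ i, (1 - u * a i))⁻¹ *
          ((t * (1 - u * a 0) * rootDeriv a 0) ^ e 0)⁻¹) (𝓝[≠] 0)
          (𝓝 ((-t)⁻¹ * 0 ^ (N + 1) * (∏ _i : Fin (N + 2), (1 : ℂ))⁻¹ *
            ((t * rootDeriv a 0) ^ e 0)⁻¹)) :=
        (((hid.pow _).const_mul _).mul
          ((tendsto_finsetProd _ fun i _ => hfac i).inv₀ (by simp))).mul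
          (((hgen 0).pow _).inv₀ (pow_ne_zero _ (mul_ne_zero ht (rootDeriv_ne_zero ha 0))))
      simp only [zero_pow (Nat.succ_ne_zero N), mul_zero, zero_mul] at hlim
      refine hlim.congr' ?_
      filter_upwards [self_mem_nhdsWithin] with u hu
      have hu : u ≠ 0 := hu
      rw [hprod hu]
      simp only [mul_inv, inv_pow, inv_inv]
      rw [pow_succ u (N + 1)]
      field_simp
    · filter_upwards [self_mem_nhdsWithin, hfac_ne] with u hu hu'
      have hu : u ≠ 0 := hu
      rw [hprod hu]
      refine mul_ne_zero (mul_ne_zero (by simp [ht, hu]) (mul_ne_zero (by simp [hu])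
        (prod_ne_zero_iff.2 fun i _ => hu' i))) (pow_ne_zero _ (mul_ne_zero
        (mul_ne_zero ht (hu' 0)) (rootDeriv_ne_zero ha 0)))

theorem eval_scaleRoots_mul (q : Polynomial ℂ) (r x : ℂ) :
    (q.scaleRoots r).eval (r * x) = r ^ q.natDegree * q.eval x := by
  simpa using Polynomial.scaleRoots_eval₂_mul (RingHom.id ℂ) x r (p := q)

theorem eval_derivative_scaleRoots_mul (q : Polynomial ℂ) {r : ℂ} (hr : r ≠ 0) {d : ℕ}
    (hd : q.natDegree = d + 1) (x : ℂ) :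
    (q.scaleRoots r).derivative.eval (r * x) = r ^ d * q.derivative.eval x := by
  have hcomp : (q.scaleRoots r).comp (Polynomial.C r * Polynomial.X) =
      Polynomial.C (r ^ (d + 1)) * q :=
    Polynomial.funext fun y => by simp [eval_scaleRoots_mul, hd]
  have h := congrArg (fun f => f.derivative.eval x) hcomp
  simp only [Polynomial.derivative_comp, Polynomial.derivative_C_mul, Polynomial.derivative_X,
    Polynomial.eval_mul, Polynomial.eval_C, Polynomial.eval_comp, Polynomial.eval_X, mul_one] at h
  refine mul_left_cancel₀ hr ?_
  rw [h]
  ring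

/-- Approximate itineraries are realised by periodic orbits: if `α ≠ β` are simple roots of `q`,
then for small `s ≠ 0` the map `s⁻¹ * q` has a cycle of length `m` with one point near `α` and the
other points near `β`. -/
theorem exists_cycle (q : Polynomial ℂ) {α β : ℂ} (hα : q.eval α = 0) (hβ : q.eval β = 0)
    (hα' : q.derivative.eval α ≠ 0) (hβ' : q.derivative.eval β ≠ 0) (m : ℕ) [NeZero m] :
    ∃ z : ℂ → ZMod m → ℂ, (∀ k, Tendsto (fun s => z s k) (𝓝 0) (𝓝 (if k = 0 then α else β))) ∧
      ∀ᶠ s in 𝓝 0, ∀ k, q.eval (z s k) = s * z s (k + 1) := by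
  obtain ⟨z, hz, hz'⟩ := exists_tendsto_eval_eq_mul q (fun k : ZMod m => k + 1)
    (fun k => if k = 0 then α else β) (fun k => by split_ifs <;> assumption)
    (fun k => by split_ifs <;> assumption)
  exact ⟨z, tendsto_pi_nhds.1 hz, hz'⟩

theorem prod_range_ite_natCast_eq_zero {m : ℕ} (hm : 0 < m) (x y : ℂ) :
    ∏ i ∈ range m, (if (i : ZMod m) = 0 then x else y) = x * y ^ (m - 1) := by
  obtain ⟨k, rfl⟩ := Nat.exists_eq_add_of_lt hm
  rw [Nat.zero_add, prod_range_succ', Nat.cast_zero, if_pos rfl, mul_comm, Nat.add_sub_cancel,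
    prod_congr rfl (g := fun _ => y), prod_const, card_range]
  intro i hi
  rw [if_neg]
  rw [ZMod.natCast_eq_zero_iff]
  exact Nat.not_dvd_of_pos_of_lt (Nat.succ_pos i) (by simpa using hi)

theorem exists_centered_eval_itineraryProd_ne_zero {N : ℕ} (m : Fin (N + 1) → ℕ)
    (hm : ∀ j, 0 < m j) {D : ℕ} (Q : MvPolynomial (Fin (N + 1)) ℂ)
    (hD : Q.IsWeightedHomogeneous m D) (hQ : Q ≠ 0) :
    ∃ a : Fin (N + 2) → ℂ, Injective a ∧ ∑ i, a i = 0 ∧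
      MvPolynomial.eval (itineraryProd (fun j => m j - 1) 1 a) Q ≠ 0 := by
  obtain ⟨t, a, ha, -, hne⟩ := exists_eval_itineraryProd_ne_zero (fun j => m j - 1) Q hQ
  refine ⟨fun i => a i - (∑ k, a k) / (N + 2 : ℕ), fun i j h => ha (sub_left_injective h), ?_, ?_⟩
  · rw [sum_sub_distrib, sum_const, card_univ, Fintype.card_fin, nsmul_eq_mul,
      mul_div_cancel₀ _ (by exact_mod_cast Nat.succ_ne_zero (N + 1)), sub_self]
  · have hW : itineraryProd (fun j => m j - 1) t a = fun j => t ^ m j *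
        itineraryProd (fun j => m j - 1) 1 (fun i => a i - (∑ k, a k) / (N + 2 : ℕ)) j := by
      funext j
      obtain ⟨k, hk⟩ := Nat.exists_eq_add_of_lt (hm j)
      simp only [itineraryProd, rootDeriv_sub_const, hk, Nat.zero_add, Nat.add_sub_cancel]
      ring
    rw [hW, eval_weighted_smul m Q hD] at hne
    exact right_ne_zero_of_mul hne

theorem exists_polynomial_eval_multipliers_ne_zero {N : ℕ} (m : Fin (N + 1) → ℕ)
    (hm : ∀ j, 0 < m j) (P : MvPolynomial (Fin (N + 1)) ℂ) (hP : P ≠ 0) :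
    ∃ (p : Polynomial ℂ) (z : Fin (N + 1) → ℂ),
      p.Monic ∧ p.natDegree = N + 2 ∧ p.coeff (N + 1) = 0 ∧
      (∀ j, Function.minimalPeriod (fun w => p.eval w) (z j) = m j) ∧
      (∀ i j, i ≠ j → ∀ a b : ℕ,
        (fun w => p.eval w)^[a] (z i) ≠ (fun w => p.eval w)^[b] (z j)) ∧
      (∀ j, deriv ((fun w => p.eval w)^[m j]) (z j) ≠ 1) ∧
      MvPolynomial.eval (fun j => deriv ((fun w => p.eval w)^[m j]) (z j)) P ≠ 0 := by
  have (j : Fin (N + 1)) : NeZero (m j) := ⟨(hm j).ne'⟩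
  set D := P.weightedTotalDegree m
  set Q := MvPolynomial.weightedHomogeneousComponent m D P
  have hQ : Q ≠ 0 := by
    obtain ⟨d, hd, hdD⟩ := exists_mem_eq_sup P.support (MvPolynomial.support_nonempty.2 hP)
      (fun d => Finsupp.weight m d)
    refine MvPolynomial.ne_zero_iff.2 ⟨d, ?_⟩
    rw [MvPolynomial.coeff_weightedHomogeneousComponent, if_pos (by exact hdD.symm)]
    exact MvPolynomial.mem_support_iff.1 hd
  obtain ⟨a, ha, hsum, hne⟩ := exists_centered_eval_itineraryProd_ne_zero m hm Q
    (MvPolynomial.weightedHomogeneousComponent_isWeightedHomogeneous D P) hQ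
  set W := itineraryProd (fun j => m j - 1) 1 a
  set q := Lagrange.nodal univ a with hq
  have hdeg : q.natDegree = N + 1 + 1 := by simp [hq]
  have hroot (i) : q.eval (a i) = 0 := Lagrange.eval_nodal_at_node (mem_univ i)
  have hroot' (i) : q.derivative.eval (a i) ≠ 0 := rootDeriv_ne_zero ha i
  choose Z hZ hZq using fun j : Fin (N + 1) =>
    exists_cycle q (hroot j.castSucc) (hroot j.succ) (hroot' _) (hroot' _) (m j)
  have hs : Tendsto (fun ρ : ℂ => ρ ^ (N + 1)) (𝓝[≠] 0) (𝓝 0) := by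
    simpa using (tendsto_nhdsWithin_of_tendsto_nhds (a := (0 : ℂ)) (s := {0}ᶜ) tendsto_id).pow
      (N + 1)
  have hs0 : ∀ᶠ ρ : ℂ in 𝓝[≠] 0, ρ ^ (N + 1) ≠ 0 := by
    filter_upwards [self_mem_nhdsWithin] with ρ hρ using pow_ne_zero _ hρ
  let μ (ρ : ℂ) (j : Fin (N + 1)) : ℂ :=
    ∏ i ∈ range (m j), q.derivative.eval (Z j (ρ ^ (N + 1)) i)
  have hμ : Tendsto μ (𝓝[≠] 0) (𝓝 W) := by
    refine tendsto_pi_nhds.2 fun j => ?_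
    have hW : W j = ∏ i ∈ range (m j), q.derivative.eval
        (if (i : ZMod (m j)) = 0 then a j.castSucc else a j.succ) := by
      simp_rw [apply_ite (fun x => q.derivative.eval x)]
      rw [prod_range_ite_natCast_eq_zero (hm j)]
      simp [W, itineraryProd, rootDeriv, hq]
    rw [hW]
    exact tendsto_finsetProd _ fun i _ =>
      (q.derivative.continuous.tendsto _).comp ((hZ j i).comp hs)
  have hW0 (j) : W j ≠ 0 := by
    simp [W, itineraryProd, rootDeriv_ne_zero ha]
  have hP' : ∀ᶠ ρ : ℂ in 𝓝[≠] 0,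
      MvPolynomial.eval (fun j => (ρ ^ (N + 1))⁻¹ ^ m j * μ ρ j) P ≠ 0 :=
    ((tendsto_eval_weighted m P hs hs0 hμ).eventually_ne hne).mono
      fun ρ h => right_ne_zero_of_mul h
  have hmult : ∀ᶠ ρ : ℂ in 𝓝[≠] 0, ∀ j, (ρ ^ (N + 1))⁻¹ ^ m j * μ ρ j ≠ 1 := by
    refine eventually_all.2 fun j => ?_
    have hlim := (tendsto_pi_nhds.1 hμ j).sub (hs.pow (m j))
    rw [zero_pow (hm j).ne', sub_zero] at hlim
    filter_upwards [hlim.eventually_ne (hW0 j), hs0] with ρ h1 h0 h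
    rw [inv_pow, inv_mul_eq_one₀ (pow_ne_zero _ h0)] at h
    exact h1 (sub_eq_zero.2 h.symm)
  have hper : ∀ᶠ ρ : ℂ in 𝓝[≠] 0, ∀ j, ∀ k : ZMod (m j), k ≠ 0 →
      Z j (ρ ^ (N + 1)) k ≠ Z j (ρ ^ (N + 1)) 0 := by
    refine eventually_all.2 fun j => eventually_all.2 fun k => ?_
    by_cases hk : k = 0
    · simp [hk]
    · have hlim := ((hZ j k).sub (hZ j 0)).comp hs
      rw [if_neg hk, if_pos rfl] at hlim
      filter_upwards [hlim.eventually_ne (sub_ne_zero.2 (ha.ne j.castSucc_lt_succ.ne'))]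
        with ρ h _ using sub_ne_zero.1 h
  have hdisj : ∀ᶠ ρ : ℂ in 𝓝[≠] 0, ∀ i j, i < j → ∀ k : ZMod (m j),
      Z i (ρ ^ (N + 1)) 0 ≠ Z j (ρ ^ (N + 1)) k := by
    refine eventually_all.2 fun i => eventually_all.2 fun j => ?_
    by_cases hij : i < j
    · simp only [hij, true_imp_iff]
      refine eventually_all.2 fun k => ?_
      have hlim := ((hZ i 0).sub (hZ j k)).comp hs
      rw [if_pos rfl] at hlim
      refine (hlim.eventually_ne (sub_ne_zero.2 ?_)).mono fun ρ h => sub_ne_zero.1 h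
      have h1 : i.castSucc < j.castSucc := Fin.castSucc_lt_castSucc_iff.2 hij
      split_ifs
      · exact ha.ne h1.ne
      · exact ha.ne (h1.trans j.castSucc_lt_succ).ne
    · simp [hij]
  obtain ⟨ρ, hρ, hPρ, hmρ, hpρ, hdρ, hZρ⟩ := (eventually_mem_nhdsWithin.and
    (hP'.and (hmult.and (hper.and (hdisj.and (hs.eventually (eventually_all.2 hZq))))))).exists
  have hρ : ρ ≠ 0 := hρ
  set p := q.scaleRoots ρ⁻¹ with hp
  set f : ℂ → ℂ := fun w => p.eval w with hf
  have hstep (j) (k : ZMod (m j)) :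
      f (ρ⁻¹ * Z j (ρ ^ (N + 1)) k) = ρ⁻¹ * Z j (ρ ^ (N + 1)) (k + 1) := by
    simp only [hf, hp]
    rw [eval_scaleRoots_mul, hdeg, hZρ, inv_pow, pow_succ ρ (N + 1)]
    field_simp
  have hiter (j) (i : ℕ) : f^[i] (ρ⁻¹ * Z j (ρ ^ (N + 1)) 0) = ρ⁻¹ * Z j (ρ ^ (N + 1)) i := by
    induction i with
    | zero => simp
    | succ i ih => rw [iterate_succ_apply', ih, hstep, Nat.cast_succ]
  have hderiv (j) : deriv f^[m j] (ρ⁻¹ * Z j (ρ ^ (N + 1)) 0) =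
      (ρ ^ (N + 1))⁻¹ ^ m j * μ ρ j := by
    rw [(hasDerivAt_eval_iterate p _ _).deriv]
    simp_rw [← hf, hiter, hp, eval_derivative_scaleRoots_mul q (inv_ne_zero hρ) hdeg]
    rw [prod_mul_distrib, prod_const, card_range, inv_pow]
  have hdisjoint (i j) (hij : i < j) (b c : ℕ) :
      f^[b] (ρ⁻¹ * Z i (ρ ^ (N + 1)) 0) ≠ f^[c] (ρ⁻¹ * Z j (ρ ^ (N + 1)) 0) := by
    intro h
    have h' := congrArg f^[(m i - 1) * b] h
    rw [← iterate_add_apply, ← iterate_add_apply, hiter, hiter] at h'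
    have hb : (m i - 1) * b + b = m i * b := by
      rw [← Nat.succ_mul, Nat.succ_eq_add_one, Nat.sub_add_cancel (hm i)]
    rw [hb, Nat.cast_mul, ZMod.natCast_self, zero_mul] at h'
    exact hdρ i j hij _ (mul_left_cancel₀ (inv_ne_zero hρ) h')
  refine ⟨p, fun j => ρ⁻¹ * Z j (ρ ^ (N + 1)) 0, ?_, ?_, ?_, fun j => ?_, fun i j hij b c => ?_,
    fun j => ?_, ?_⟩
  · exact (Polynomial.monic_scaleRoots_iff _).2 Lagrange.nodal_monic
  · rw [hp, Polynomial.natDegree_scaleRoots, hdeg]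
  · have := Polynomial.prod_X_sub_C_coeff_card_pred univ a (by simp)
    rw [hsum, neg_zero, ← Lagrange.nodal_eq, card_univ, Fintype.card_fin] at this
    rw [hp, Polynomial.coeff_scaleRoots, hq]
    exact mul_eq_zero_of_left this _
  · refine Nat.dvd_antisymm (IsPeriodicPt.minimalPeriod_dvd ?_) ?_
    · rw [IsPeriodicPt, IsFixedPt, hiter, ZMod.natCast_self]
    · rw [← ZMod.natCast_eq_zero_iff]
      by_contra hk
      refine hpρ j _ hk (mul_left_cancel₀ (inv_ne_zero hρ) ?_)
      rw [← hiter, iterate_minimalPeriod]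
  · rcases lt_or_gt_of_ne hij with h | h
    · exact hdisjoint i j h b c
    · exact (hdisjoint j i h c b).symm
  · rw [hderiv]
    exact hmρ j
  · change MvPolynomial.eval (fun j => deriv f^[m j] _) P ≠ 0
    rwa [funext hderiv]

/-- For `n ≥ 3` and positive integers `m_1, …, m_{n-1}`, the multipliers of
`n-1` distinct periodic orbits of periods `m_1, …, m_{n-1}` satisfy no nonzero polynomial
relation over `ℂ`: for every nonzero `P ∈ ℂ[X_1,…,X_{n-1}]` there is a monic centered
polynomial `p` of degree `n` and periodic points `z_j` of minimal period `m_j`, in pairwise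
distinct orbits, each with multiplier `≠ 1`, such that `P` does not vanish at the multipliers. -/
theorem multipliers_algebraically_independent
    (n : ℕ) (hn : 3 ≤ n) (m : Fin (n - 1) → ℕ) (hm : ∀ j, 0 < m j)
    (P : MvPolynomial (Fin (n - 1)) ℂ) (hP : P ≠ 0) :
    ∃ (p : Polynomial ℂ) (z : Fin (n - 1) → ℂ),
      p.Monic ∧ p.natDegree = n ∧ p.coeff (n - 1) = 0 ∧
      (∀ j, Function.minimalPeriod (fun w => p.eval w) (z j) = m j) ∧
      (∀ i j, i ≠ j → ∀ a b : ℕ,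
        (fun w => p.eval w)^[a] (z i) ≠ (fun w => p.eval w)^[b] (z j)) ∧
      (∀ j, deriv ((fun w => p.eval w)^[m j]) (z j) ≠ 1) ∧
      MvPolynomial.eval (fun j => deriv ((fun w => p.eval w)^[m j]) (z j)) P ≠ 0 := by
  obtain ⟨N, rfl⟩ : ∃ N, n = N + 2 := ⟨n - 2, by omega⟩
  exact exists_polynomial_eval_multipliers_ne_zero m hm P hP
end

section
/- Let n ≥ 2 and let m_1, …, m_{n-1} be positive integers. Identify 𝒫^n with ℂ^{n-1} via the coefficients, writing p_c(z) = z^n + c_{n-2} z^{n-2} + ⋯ + c_1 z + c_0 for c = (c_0, …, c_{n-2}) ∈ ℂ^{n-1}. Then there exist a point c* ∈ ℂ^{n-1}, an open neighborhood U of c*, and holomorphic functions z_1, …, z_{n-1} : U → ℂ such that for every c ∈ U the point z_j(c) is a periodic point of p_c of minimal period m_j, the points z_1(c), …, z_{n-1}(c) lie in pairwise distinct periodic orbits, and the multiplier map Λ : U → ℂ^{n-1} given by Λ(c) = ((p_c^{∘m_1})'(z_1(c)), …, (p_c^{∘m_{n-1}})'(z_{n-1}(c))) has invertible (Fréchet)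 derivative at c*; in particular Λ is a local biholomorphism at c*. -/
open Function

/-- The monic centered polynomial of degree `n` with coefficient tuple `c = (c_0, …, c_{n-2})`:
`p_c(z) = z^n + c_{n-2} z^{n-2} + ⋯ + c_1 z + c_0`. -/
noncomputable def pc (n : ℕ) (c : Fin (n - 1) → ℂ) (z : ℂ) : ℂ :=
  z ^ n + ∑ i : Fin (n - 1), c i * z ^ (i : ℕ)

/-- If no nonzero linear functional vanishes on any of the sets `A j ⊆ K^ι`, then linearly
independent representatives of the `A j` can be chosen. -/
lemma exists_linearIndependent_mem {K ι : Type*} [Field K] [Fintype ι] [DecidableEq ι]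
    (A : ι → Set (ι → K))
    (hA : ∀ j, ∀ a : ι → K, (∀ v ∈ A j, ∑ k, a k * v k = 0) → a = 0) :
    ∃ v : ι → ι → K, (∀ j, v j ∈ A j) ∧ LinearIndependent K v := by
  suffices H : ∀ s : Finset ι, ∃ v : ι → ι → K, (∀ j ∈ s, v j ∈ A j) ∧
      LinearIndepOn K v (s : Set ι) by
    obtain ⟨v, hv, hli⟩ := H Finset.univ
    exact ⟨v, fun j => hv j (Finset.mem_univ j), by
      rwa [Finset.coe_univ, linearIndepOn_univ_iff] at hli⟩
  intro s
  induction s using Finset.induction_on with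
  | empty => exact ⟨0, by simp, by simp⟩
  | insert a s has ih =>
    obtain ⟨v, hv, hli⟩ := ih
    have hlt : Submodule.span K (v '' (s : Set ι)) < ⊤ := by
      refine Submodule.lt_top_of_finrank_lt_finrank ?_
      rw [Module.finrank_fintype_fun_eq_card]
      refine lt_of_le_of_lt ?_ (Finset.card_lt_univ_of_notMem has)
      classical
      rw [← Finset.coe_image]
      exact (finrank_span_finset_le_card _).trans Finset.card_image_le
    obtain ⟨f, hf0, hf⟩ := Submodule.exists_le_ker_of_lt_top _ hlt
    obtain ⟨x, hxA, hfx⟩ : ∃ x ∈ A a, f x ≠ 0 := by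
      by_contra! hcon
      refine hf0 ?_
      have key : ∀ x, f x = ∑ k, f (Pi.single k 1) * x k := fun x => by
        rw [LinearMap.pi_apply_eq_sum_univ f x]
        refine Finset.sum_congr rfl fun k _ => ?_
        rw [smul_eq_mul, mul_comm]
        congr 2
        ext i
        simp [Pi.single_apply, eq_comm]
      have h0 := hA a (fun k => f (Pi.single k 1)) fun x hx => by rw [← key]; exact hcon x hx
      ext1 k
      ext
      simpa using congrFun h0 k
    have hagree : Set.EqOn (Function.update v a x) v s := fun i hi =>
      Function.update_of_ne (fun h => has (by simpa [h] using hi)) _ _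
    refine ⟨Function.update v a x, ?_, ?_⟩
    · intro j hj
      rcases eq_or_ne j a with rfl | hja
      · simpa using hxA
      · rw [Function.update_of_ne hja]
        exact hv j ((Finset.mem_insert.1 hj).resolve_left hja)
    · rw [Finset.coe_insert, linearIndepOn_insert (by simpa using has)]
      refine ⟨(linearIndepOn_congr hagree).2 hli, ?_⟩
      rw [Set.EqOn.image_eq hagree, Function.update_self]
      exact fun hx => hfx (hf hx)

lemma sum_properDivisors_pow_sub_one_lt {n m : ℕ} (hn : 2 ≤ n) (hm : 0 < m) :
    ∑ d ∈ m.properDivisors, (n ^ d - 1) < n ^ (m - 1) := by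
  have key : ∀ k, ∑ d ∈ Finset.Icc 1 (k + 1), (n ^ d - 1) < n ^ (2 * k + 1) := by
    intro k
    induction k with
    | zero => simp; omega
    | succ k ih =>
      rw [Finset.sum_Icc_succ_top (by omega)]
      have h1 : n ^ (k + 1 + 1) ≤ n ^ (2 * k + 2) := Nat.pow_le_pow_right (by omega) (by omega)
      have h2 : n ^ (2 * k + 1) ≤ n ^ (2 * k + 2) := Nat.pow_le_pow_right (by omega) (by omega)
      have h3 : n ^ (2 * (k + 1) + 1) = n * n ^ (2 * k + 2) := by ring
      have h4 : 2 * n ^ (2 * k + 2) ≤ n * n ^ (2 * k + 2) := Nat.mul_le_mul_right _ hn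
      omega
  rcases (show m = 1 ∨ 2 ≤ m by omega) with rfl | h2
  · simp
  · obtain ⟨k, hk⟩ : ∃ k, m / 2 = k + 1 := ⟨m / 2 - 1, by omega⟩
    calc ∑ d ∈ m.properDivisors, (n ^ d - 1)
        ≤ ∑ d ∈ Finset.Icc 1 (k + 1), (n ^ d - 1) := by
          refine Finset.sum_le_sum_of_subset fun d hd => ?_
          rw [Nat.mem_properDivisors] at hd
          obtain ⟨⟨q, rfl⟩, hlt⟩ := hd
          have hd0 : 0 < d := Nat.pos_of_ne_zero (by rintro rfl; simp at hlt)
          have hq : 2 ≤ q := by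
            by_contra! h
            interval_cases q <;> omega
          have : d * 2 ≤ d * q := Nat.mul_le_mul_left _ hq
          rw [Finset.mem_Icc]
          omega
      _ < n ^ (2 * k + 1) := key k
      _ ≤ n ^ (m - 1) := Nat.pow_le_pow_right (by omega) (by omega)

lemma iterate_pow_const {M : Type*} [Monoid M] (n k : ℕ) (x : M) :
    (fun z : M => z ^ n)^[k] x = x ^ n ^ k := by
  induction k with
  | zero => simp
  | succ k ih => rw [Function.iterate_succ_apply', ih, ← pow_mul, pow_succ]

open Polynomial in
/-- The orbit sums `∑ i < m, y ^ (e n ^ i)`, `1 ≤ e < n`, satisfy no common linear relation on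
the nonzero points `y` of exact period `m` under `z ↦ z ^ n`. -/
lemma eq_zero_of_forall_orbitSum_eq_zero {ι : Type*} [Fintype ι] {n m : ℕ} (hn : 2 ≤ n)
    (hm : 0 < m) {e : ι → ℕ} (he : Function.Injective e) (he1 : ∀ k, 1 ≤ e k)
    (hen : ∀ k, e k < n) (a : ι → ℂ)
    (ha : ∀ y : ℂ, y ≠ 0 → minimalPeriod (fun z : ℂ => z ^ n) y = m →
      ∑ k, a k * ∑ i ∈ Finset.range m, y ^ (e k * n ^ i) = 0) :
    a = 0 := by
  classical
  set F : ℂ[X] := ∑ k, C (a k) * ∑ i ∈ Finset.range m, X ^ (e k * n ^ i) with hF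
  set G : ℂ[X] := ∏ d ∈ m.properDivisors, (X ^ (n ^ d - 1) - 1) with hG
  have hFeval : ∀ y, F.eval y = ∑ k, a k * ∑ i ∈ Finset.range m, y ^ (e k * n ^ i) := fun y => by
    simp [hF, eval_finsetSum]
  have hpow : 2 ≤ n ^ m := hn.trans (Nat.le_self_pow hm.ne' n)
  have hGne : G ≠ 0 := by
    rw [hG, Finset.prod_ne_zero_iff]
    intro d hd
    have hd0 : 0 < d := Nat.pos_of_mem_properDivisors hd
    have : 2 ≤ n ^ d := hn.trans (Nat.le_self_pow hd0.ne' n)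
    exact X_pow_sub_C_ne_zero (by omega) (1 : ℂ)
  have hFdeg : F.natDegree ≤ (n - 1) * n ^ (m - 1) := by
    refine natDegree_sum_le_of_forall_le _ _ fun k _ => ?_
    refine (natDegree_C_mul_le _ _).trans ?_
    refine natDegree_sum_le_of_forall_le _ _ fun i hi => ?_
    rw [natDegree_X_pow]
    have hi' := Finset.mem_range.1 hi
    exact Nat.mul_le_mul (by have := hen k; omega) (Nat.pow_le_pow_right (by omega) (by omega))
  have hGdeg : G.natDegree < n ^ (m - 1) := by
    refine lt_of_le_of_lt ?_ (sum_properDivisors_pow_sub_one_lt hn hm)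
    refine (natDegree_prod_le _ _).trans (Finset.sum_le_sum fun d _ => ?_)
    exact (natDegree_X_pow_sub_C (n := n ^ d - 1) (r := (1 : ℂ))).le
  have hFG : F * G = 0 := by
    refine eq_zero_of_natDegree_lt_card_of_eval_eq_zero' _
      (insert 0 (nthRootsFinset (n ^ m - 1) (1 : ℂ))) ?_ ?_
    · intro y hy
      rw [eval_mul]
      rcases Finset.mem_insert.1 hy with rfl | hy
      · rw [hFeval, Finset.sum_eq_zero, zero_mul]
        intro k _
        rw [Finset.sum_eq_zero, mul_zero]
        intro i _
        exact zero_pow (Nat.mul_pos (he1 k) (by positivity)).ne'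
      · rw [mem_nthRootsFinset (by omega)] at hy
        have hy0 : y ≠ 0 := by
          rintro rfl
          rw [zero_pow (by omega)] at hy
          exact zero_ne_one hy
        by_cases hper : minimalPeriod (fun z : ℂ => z ^ n) y = m
        · rw [hFeval, ha y hy0 hper, zero_mul]
        · have hp : IsPeriodicPt (fun z : ℂ => z ^ n) m y := by
            rw [IsPeriodicPt, IsFixedPt, iterate_pow_const,
              ← Nat.sub_add_cancel (show 1 ≤ n ^ m by omega), pow_succ, hy, one_mul]
          set d := minimalPeriod (fun z : ℂ => z ^ n) y with hd
          have hdvd : d ∣ m := hp.minimalPeriod_dvd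
          have hdm : d ∈ m.properDivisors :=
            Nat.mem_properDivisors.2 ⟨hdvd, lt_of_le_of_ne (Nat.le_of_dvd hm hdvd) hper⟩
          have hyd : y ^ n ^ d = y := by
            rw [← iterate_pow_const]
            exact iterate_minimalPeriod
          have hd1 : 1 ≤ n ^ d := Nat.one_le_pow _ _ (by omega)
          have hyd' : y ^ (n ^ d - 1) = 1 := by
            rw [← Nat.sub_add_cancel hd1, pow_succ] at hyd
            exact mul_right_cancel₀ hy0 (by rw [hyd, one_mul])
          rw [hG, eval_prod, Finset.prod_eq_zero hdm, mul_zero]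
          simp [hyd']
    · have hcard : (nthRootsFinset (n ^ m - 1) (1 : ℂ)).card = n ^ m - 1 :=
        (Complex.isPrimitiveRoot_exp _ (by omega)).card_nthRootsFinset
      rw [Finset.card_insert_of_notMem, hcard]
      · have h1 : (n - 1) * n ^ (m - 1) + n ^ (m - 1) = n ^ m := by
          obtain ⟨m, rfl⟩ : ∃ k, m = k + 1 := ⟨m - 1, by omega⟩
          obtain ⟨n, rfl⟩ : ∃ k, n = k + 1 := ⟨n - 1, by omega⟩
          simp only [Nat.add_sub_cancel]
          ring
        have := natDegree_mul_le (p := F) (q := G)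
        omega
      · rw [mem_nthRootsFinset (by omega), zero_pow (by omega)]
        exact zero_ne_one
  have hF0 : F = 0 := (mul_eq_zero.1 hFG).resolve_right hGne
  funext k
  have hc := congrArg (fun p : ℂ[X] => p.coeff (e k)) hF0
  have hiff : ∀ k', ∀ i, e k = e k' * n ^ i ↔ k' = k ∧ i = 0 := by
    intro k' i
    constructor
    · intro h
      rcases Nat.eq_zero_or_pos i with rfl | hi
      · exact ⟨(he (by simpa using h)).symm, rfl⟩
      · have h1 : n ≤ n ^ i := Nat.le_self_pow hi.ne' n
        have h2 : 1 * n ^ i ≤ e k' * n ^ i := Nat.mul_le_mul_right _ (he1 k')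
        have := hen k
        omega
    · rintro ⟨rfl, rfl⟩
      simp
  simp only [hF, finsetSum_coeff, coeff_C_mul, coeff_X_pow, hiff, coeff_zero] at hc
  rw [Finset.sum_eq_single k (fun k' _ hk => by simp [hk]) (by simp)] at hc
  simpa [hm] using hc

lemma minimalPeriod_pow_inv (n : ℕ) (y : ℂ) :
    minimalPeriod (fun z : ℂ => z ^ n) y⁻¹ = minimalPeriod (fun z : ℂ => z ^ n) y := by
  rw [minimalPeriod_eq_minimalPeriod_iff]
  intro k
  simp only [IsPeriodicPt, IsFixedPt, iterate_pow_const, inv_pow, inv_inj]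

/-- The vector with entries `∑ 1 / ζ ^ (n - k)`, `k < n - 1`, the sum being over the first `m`
points `ζ` of the orbit of `w` under `z ↦ z ^ n`. -/
noncomputable def orbitSum (n m : ℕ) (w : ℂ) (k : Fin (n - 1)) : ℂ :=
  ∑ i ∈ Finset.range m, ((w ^ n ^ i) ^ (n - (k : ℕ)))⁻¹

lemma orbitSum_pow {n m : ℕ} {w : ℂ} (hw : w ^ n ^ m = w) :
    orbitSum n m (w ^ n) = orbitSum n m w := by
  funext k
  have h := (Finset.sum_range_succ' (fun i => ((w ^ n ^ i) ^ (n - (k : ℕ)))⁻¹) m).symm.trans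
    (Finset.sum_range_succ _ m)
  simp only [hw, pow_zero, pow_one, add_left_inj] at h
  rw [orbitSum, orbitSum, ← h]
  simp only [← pow_mul, pow_succ', mul_assoc]

lemma orbitSum_iterate {n m : ℕ} {w : ℂ} (hw : w ^ n ^ m = w) (a : ℕ) :
    orbitSum n m ((fun z : ℂ => z ^ n)^[a] w) = orbitSum n m w := by
  induction a with
  | zero => rfl
  | succ a ih =>
    rw [iterate_succ_apply', orbitSum_pow, ih]
    rw [iterate_pow_const, ← pow_mul, mul_comm, pow_mul, hw]

/-- Points of prescribed exact periods under `z ↦ z ^ n` can be chosen with linearly independent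
vectors of orbit sums. -/
lemma exists_linearIndependent_orbitSum {n : ℕ} (hn : 2 ≤ n) (m : Fin (n - 1) → ℕ)
    (hm : ∀ j, 0 < m j) :
    ∃ w : Fin (n - 1) → ℂ, (∀ j, w j ≠ 0 ∧ minimalPeriod (fun z : ℂ => z ^ n) (w j) = m j) ∧
      LinearIndependent ℂ (fun j => orbitSum n (m j) (w j)) := by
  obtain ⟨v, hv, hli⟩ := exists_linearIndependent_mem (K := ℂ)
    (fun j : Fin (n - 1) => orbitSum n (m j) ''
      {w | w ≠ 0 ∧ minimalPeriod (fun z : ℂ => z ^ n) w = m j}) (by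
    intro j a ha
    refine eq_zero_of_forall_orbitSum_eq_zero hn (hm j)
      (e := fun k : Fin (n - 1) => if (k : ℕ) = 0 then 1 else n - k) ?_ ?_ ?_ a ?_
    · intro k l hkl
      have := k.2
      have := l.2
      ext
      dsimp only at hkl
      split_ifs at hkl <;> omega
    · intro k
      have := k.2
      split_ifs <;> omega
    · intro k
      have := k.2
      split_ifs <;> omega
    · intro y hy hper
      have hyp : y ^ n ^ m j = y := by
        rw [← iterate_pow_const, ← hper]
        exact iterate_minimalPeriod
      rw [← ha _ ⟨y⁻¹, ⟨inv_ne_zero hy, by rw [minimalPeriod_pow_inv, hper]⟩, rfl⟩]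
      refine Finset.sum_congr rfl fun k _ => ?_
      congr 1
      have hk : orbitSum n (m j) y⁻¹ k = ∑ i ∈ Finset.range (m j), y ^ ((n - k) * n ^ i) := by
        refine Finset.sum_congr rfl fun i _ => ?_
        rw [inv_pow, inv_pow, inv_inv, ← pow_mul, mul_comm]
      rw [hk]
      split_ifs with h0
      · have h := (Finset.sum_range_succ' (fun i => y ^ n ^ i) (m j)).symm.trans
          (Finset.sum_range_succ _ (m j))
        simp only [hyp, pow_zero, pow_one, add_left_inj] at h
        simp only [one_mul, h0, Nat.sub_zero, ← pow_succ', h]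
      · rfl)
  choose w hw hwv using hv
  obtain rfl : (fun j => orbitSum n (m j) (w j)) = v := funext hwv
  exact ⟨w, hw, hli⟩

lemma pc_zero (n : ℕ) : pc n 0 = fun z => z ^ n := by
  funext z
  simp [pc]

/-- The derivative of `pc n c`. -/
noncomputable def pcDeriv (n : ℕ) (c : Fin (n - 1) → ℂ) (z : ℂ) : ℂ :=
  n * z ^ (n - 1) + ∑ i : Fin (n - 1), c i * ((i : ℕ) * z ^ ((i : ℕ) - 1))

lemma hasDerivAt_pc (n : ℕ) (c : Fin (n - 1) → ℂ) (z : ℂ) :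
    HasDerivAt (pc n c) (pcDeriv n c z) z :=
  (hasDerivAt_pow n z).add
    (HasDerivAt.fun_sum fun i _ => (hasDerivAt_pow (i : ℕ) z).const_mul (c i))

lemma hasDerivAt_iterate_pc (n : ℕ) (c : Fin (n - 1) → ℂ) (m : ℕ) (z : ℂ) :
    HasDerivAt (pc n c)^[m] (∏ i ∈ Finset.range m, pcDeriv n c ((pc n c)^[i] z)) z := by
  induction m with
  | zero => simpa using hasDerivAt_id z
  | succ m ih =>
    rw [Finset.prod_range_succ, mul_comm, iterate_succ']
    exact (hasDerivAt_pc n c _).comp z ih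

lemma contDiff_iterate_pc (n k : ℕ) :
    ContDiff ℂ 1 (fun p : (Fin (n - 1) → ℂ) × ℂ => (pc n p.1)^[k] p.2) := by
  induction k with
  | zero => exact contDiff_snd
  | succ k ih =>
    simp only [iterate_succ_apply']
    unfold pc at ih ⊢
    fun_prop

lemma contDiff_pcDeriv (n : ℕ) :
    ContDiff ℂ 1 (fun p : (Fin (n - 1) → ℂ) × ℂ => pcDeriv n p.1 p.2) := by
  unfold pcDeriv
  fun_prop

/-- The multiplier depends smoothly on the polynomial and the point. -/
lemma contDiff_prod_pcDeriv (n m : ℕ) :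
    ContDiff ℂ 1 (fun p : (Fin (n - 1) → ℂ) × ℂ =>
      ∏ i ∈ Finset.range m, pcDeriv n p.1 ((pc n p.1)^[i] p.2)) :=
  contDiff_prod fun i _ => (contDiff_pcDeriv n).comp (contDiff_fst.prodMk (contDiff_iterate_pc n i))

/-- Implicit function theorem for one scalar equation in one scalar unknown. -/
lemma exists_implicit_differentiable {E : Type*} [NormedAddCommGroup E] [NormedSpace ℂ E]
    [CompleteSpace E] {f : E × ℂ → ℂ} (hf : ContDiff ℂ 1 f) {c₀ : E} {w : ℂ} {d : ℂ}
    (hd : HasDerivAt (fun z => f (c₀, z)) d w) (hd0 : d ≠ 0) :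
    ∃ ψ : E → ℂ, ψ c₀ = w ∧ ∀ᶠ c in nhds c₀, DifferentiableAt ℂ ψ c ∧ f (c, ψ c) = f (c₀, w) := by
  have cdf : ContDiffAt ℂ 1 f (c₀, w) := hf.contDiffAt
  have hinr : fderiv ℂ f (c₀, w) ∘L .inr ℂ E ℂ = ContinuousLinearMap.toSpanSingleton ℂ d := by
    ext
    have h1 : HasFDerivAt f (fderiv ℂ f (c₀, w)) (c₀, w) :=
      (hf.differentiable one_ne_zero _).hasFDerivAt
    have h2 := (h1.comp w (hasFDerivAt_prodMk_right c₀ w)).hasDerivAt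
    simpa using h2.unique hd
  have hinv : (fderiv ℂ f (c₀, w) ∘L .inr ℂ E ℂ).IsInvertible := by
    rw [hinr]
    exact ⟨ContinuousLinearEquiv.unitsEquivAut ℂ (Units.mk0 d hd0), by ext; simp⟩
  refine ⟨cdf.implicitFunction one_ne_zero hinv, cdf.implicitFunction_apply_self one_ne_zero hinv,
    ?_⟩
  filter_upwards [cdf.eventually_apply_implicitFunction one_ne_zero hinv,
    (cdf.contDiffAt_implicitFunction one_ne_zero hinv).eventually (by simp)] with c h1 h2
  exact ⟨h2.differentiableAt one_ne_zero, h1⟩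

/-- First variation at `z ↦ z ^ n`, in the direction `h`, of the logarithm of the multiplier of a
periodic point. -/
lemma logDeriv_multiplier {n m : ℕ} (hn : 2 ≤ n) (h : Fin (n - 1) → ℂ) {x : ℂ → ℂ}
    (hx : DifferentiableAt ℂ x 0) (hx0 : x 0 ≠ 0)
    (hper : ∀ᶠ t in nhds (0 : ℂ), (pc n (t • h))^[m] (x t) = x t) :
    logDeriv (fun t => ∏ i ∈ Finset.range m, pcDeriv n (t • h) ((pc n (t • h))^[i] (x t))) 0 =
      ∑ k : Fin (n - 1), (((k : ℕ) : ℂ) / n - 1) * h k * orbitSum n m (x 0) k := by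
  set y : ℕ → ℂ → ℂ := fun i t => (pc n (t • h))^[i] (x t) with hy
  set w : ℕ → ℂ := fun i => x 0 ^ n ^ i with hw
  have hn0 : (n : ℂ) ≠ 0 := by
    exact_mod_cast (by omega : n ≠ 0)
  have hw0 : ∀ i, w i ≠ 0 := fun i => pow_ne_zero _ hx0
  have hy0 : ∀ i, y i 0 = w i := fun i => by simp [hy, hw, pc_zero, iterate_pow_const]
  have hyd : ∀ i, DifferentiableAt ℂ (y i) 0 := by
    intro i
    have h1 : DifferentiableAt ℂ (fun p : (Fin (n - 1) → ℂ) × ℂ => (pc n p.1)^[i] p.2)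
        ((0 : ℂ) • h, x 0) := (contDiff_iterate_pc n i).differentiable one_ne_zero _
    have h2 : DifferentiableAt ℂ (fun t : ℂ => (t • h, x t)) 0 := by fun_prop
    exact h1.comp (0 : ℂ) h2
  have hpert : ∀ q : Fin (n - 1) → ℂ → ℂ, (∀ k, DifferentiableAt ℂ (q k) 0) →
      HasDerivAt (fun t : ℂ => ∑ k, (t • h) k * q k t) (∑ k, h k * q k 0) 0 := by
    intro q hq
    refine HasDerivAt.fun_sum fun k _ => ?_
    have h1 : HasDerivAt (fun t : ℂ => (t • h) k) (h k) 0 := by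
      simpa using (hasDerivAt_id (0 : ℂ)).mul_const (h k)
    simpa using h1.fun_mul (hq k).hasDerivAt
  set u : ℕ → ℂ := fun i => deriv (y i) 0 with hu
  have hrec : ∀ i, u (i + 1) = n * w i ^ (n - 1) * u i + ∑ k, h k * w i ^ (k : ℕ) := by
    intro i
    have h1 := ((hyd i).hasDerivAt.pow n).add
      (hpert (fun k t => y i t ^ (k : ℕ)) fun k => (hyd i).pow _)
    rw [hy0] at h1
    refine (HasDerivAt.deriv (h1.congr_of_eventuallyEq (.of_forall fun t => ?_)))
    simp only [hy, iterate_succ_apply']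
    rfl
  have hfac : ∀ i, logDeriv (fun t => pcDeriv n (t • h) (y i t)) 0 =
      (n - 1) * (u i / w i) + ∑ k : Fin (n - 1), ((k : ℕ) : ℂ) / n * h k * (w i ^ (n - (k : ℕ)))⁻¹ := by
    intro i
    have h1 := (((hyd i).hasDerivAt.pow (n - 1)).const_mul (n : ℂ)).add
      (hpert (fun k t => (k : ℕ) * y i t ^ ((k : ℕ) - 1)) fun k => ((hyd i).pow _).const_mul _)
    have h2 : deriv (fun t => pcDeriv n (t • h) (y i t)) 0 = _ := h1.deriv
    rw [logDeriv_apply, h2, zero_smul, hy0]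
    have h3 : pcDeriv n 0 (w i) = n * w i ^ (n - 1) := by simp [pcDeriv]
    rw [h3, add_div, Finset.sum_div]
    congr 1
    · obtain ⟨l, rfl⟩ : ∃ l, n = l + 2 := ⟨n - 2, by omega⟩
      have := hw0 i
      simp only [Nat.add_sub_cancel, show l + 2 - 1 = l + 1 by omega]
      push_cast at hn0 ⊢
      field_simp
      simp only [hu]
      ring
    · refine Finset.sum_congr rfl fun k _ => ?_
      have hk := k.2
      have := hw0 i
      rcases Nat.eq_zero_or_pos (k : ℕ) with hk0 | hk0
      · simp [hk0]
      · rw [show w i ^ (n - 1) = w i ^ ((k : ℕ) - 1) * w i ^ (n - (k : ℕ)) by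
          rw [← pow_add]; congr 1; omega]
        field_simp
  have hratio : ∀ i, u (i + 1) / w (i + 1) =
      n * (u i / w i) + ∑ k, h k * (w i ^ (n - (k : ℕ)))⁻¹ := by
    intro i
    have hws : w (i + 1) = w i ^ n := by simp only [hw, ← pow_mul, pow_succ]
    have := hw0 i
    rw [hrec, hws, add_div, Finset.sum_div]
    congr 1
    · rw [show w i ^ n = w i ^ (n - 1) * w i by rw [← pow_succ]; congr 1; omega]
      field_simp
    · refine Finset.sum_congr rfl fun k _ => ?_
      rw [show w i ^ n = w i ^ (k : ℕ) * w i ^ (n - (k : ℕ)) by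
        rw [← pow_add]; congr 1; have := k.2; omega]
      field_simp
  have hcycle : u m / w m = u 0 / w 0 := by
    have hev : y m =ᶠ[nhds 0] y 0 := hper
    rw [← hy0, ← hy0, hev.eq_of_nhds]
    simp only [hu, hev.deriv_eq]
  have hsum : (n - 1) * ∑ i ∈ Finset.range m, u i / w i =
      -∑ i ∈ Finset.range m, ∑ k, h k * (w i ^ (n - (k : ℕ)))⁻¹ := by
    have h1 := (Finset.sum_range_succ' (fun i => u i / w i) m).symm.trans
      (Finset.sum_range_succ _ m)
    rw [hcycle, add_left_inj] at h1
    simp only [hratio, Finset.sum_add_distrib, ← Finset.mul_sum] at h1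
    linear_combination h1
  rw [logDeriv_prod]
  · rw [Finset.sum_congr rfl fun i _ => hfac i, Finset.sum_add_distrib, ← Finset.mul_sum, hsum]
    rw [neg_add_eq_sub, ← Finset.sum_sub_distrib]
    simp only [← Finset.sum_sub_distrib, orbitSum, Finset.mul_sum]
    rw [Finset.sum_comm]
    refine Finset.sum_congr rfl fun k _ => Finset.sum_congr rfl fun i _ => ?_
    ring
  · intro i _
    have h3 : pcDeriv n 0 (w i) = n * w i ^ (n - 1) := by simp [pcDeriv]
    change pcDeriv n ((0 : ℂ) • h) (y i 0) ≠ 0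
    rw [zero_smul, hy0, h3]
    exact mul_ne_zero hn0 (pow_ne_zero _ (hw0 i))
  · intro i _
    have h1 : DifferentiableAt ℂ (fun p : (Fin (n - 1) → ℂ) × ℂ => pcDeriv n p.1 p.2)
        ((0 : ℂ) • h, y i 0) := (contDiff_pcDeriv n).differentiable one_ne_zero _
    have h2 : DifferentiableAt ℂ (fun t : ℂ => (t • h, y i t)) 0 := by
      have := hyd i
      fun_prop
    exact h1.comp (0 : ℂ) h2

lemma differentiableAt_iterate_pc {n : ℕ} {E : Type*} [NormedAddCommGroup E] [NormedSpace ℂ E]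
    {c : E → Fin (n - 1) → ℂ} {ψ : E → ℂ} {p : E} (hc : DifferentiableAt ℂ c p)
    (hψ : DifferentiableAt ℂ ψ p) (i : ℕ) :
    DifferentiableAt ℂ (fun q => (pc n (c q))^[i] (ψ q)) p := by
  have h := ((contDiff_iterate_pc n i).differentiable one_ne_zero (c p, ψ p))
  exact h.comp p (hc.prodMk hψ)

lemma differentiableAt_multiplier {n : ℕ} {ψ : (Fin (n - 1) → ℂ) → ℂ} {c : Fin (n - 1) → ℂ}
    (hψ : DifferentiableAt ℂ ψ c) (m : ℕ) :
    DifferentiableAt ℂ (fun c => deriv ((pc n c)^[m]) (ψ c)) c := by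
  have h := (contDiff_prod_pcDeriv n m).differentiable one_ne_zero (c, ψ c)
  refine (h.comp c (differentiableAt_id.prodMk hψ)).congr_of_eventuallyEq (.of_forall fun c' => ?_)
  exact (hasDerivAt_iterate_pc n c' m (ψ c')).deriv

/-- A nonzero periodic point of `z ↦ z ^ n` continues holomorphically to nearby polynomials. -/
lemma exists_periodicPt_continuation {n m : ℕ} (hn : 2 ≤ n) (hm : 0 < m) {w : ℂ} (hw0 : w ≠ 0)
    (hw : w ^ n ^ m = w) :
    ∃ ψ : (Fin (n - 1) → ℂ) → ℂ, ψ 0 = w ∧ ∀ᶠ c in nhds 0,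
      DifferentiableAt ℂ ψ c ∧ (pc n c)^[m] (ψ c) = ψ c := by
  have hN : 2 ≤ n ^ m := hn.trans (Nat.le_self_pow hm.ne' n)
  have hone : w ^ (n ^ m - 1) = 1 := by
    have h := hw
    rw [← Nat.sub_add_cancel (show 1 ≤ n ^ m by omega), pow_succ] at h
    exact mul_right_cancel₀ hw0 (by rw [h, one_mul])
  have hd : HasDerivAt (fun z => (pc n 0)^[m] z - z) ((n ^ m : ℕ) * 1 - 1) w := by
    have h := (hasDerivAt_pow (n ^ m) w).sub (hasDerivAt_id w)
    rw [hone] at h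
    refine h.congr_of_eventuallyEq (.of_forall fun z => ?_)
    simp [pc_zero, iterate_pow_const]
  obtain ⟨ψ, h0, hev⟩ := exists_implicit_differentiable
    (f := fun p : (Fin (n - 1) → ℂ) × ℂ => (pc n p.1)^[m] p.2 - p.2) (c₀ := 0)
    ((contDiff_iterate_pc n m).sub contDiff_snd) hd (by
      rw [mul_one, sub_ne_zero]
      exact_mod_cast (by omega : n ^ m ≠ 1))
  refine ⟨ψ, h0, hev.mono fun c hc => ⟨hc.1, ?_⟩⟩
  have h := hc.2
  simp only [pc_zero, iterate_pow_const, hw, sub_self] at h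
  exact sub_eq_zero.1 h

/-- The derivative at `z ↦ z ^ n` of a multiplier that is stationary in the direction `h` gives a
linear relation on `h`. -/
lemma sum_orbitSum_eq_zero_of_fderiv_eq_zero {n m : ℕ} (hn : 2 ≤ n) {ψ : (Fin (n - 1) → ℂ) → ℂ}
    (hψ0 : ψ 0 ≠ 0) (hψ : DifferentiableAt ℂ ψ 0)
    (hper : ∀ᶠ c in nhds 0, (pc n c)^[m] (ψ c) = ψ c) (h : Fin (n - 1) → ℂ)
    (hh : fderiv ℂ (fun c => deriv ((pc n c)^[m]) (ψ c)) 0 h = 0) :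
    ∑ k : Fin (n - 1), (((k : ℕ) : ℂ) / n - 1) * h k * orbitSum n m (ψ 0) k = 0 := by
  have hline : HasDerivAt (fun t : ℂ => t • h) h 0 := by
    simpa using (hasDerivAt_id (0 : ℂ)).smul_const h
  have htend : Filter.Tendsto (fun t : ℂ => t • h) (nhds 0) (nhds 0) :=
    Continuous.tendsto' (by fun_prop) _ _ (zero_smul ℂ h)
  have hψt : DifferentiableAt ℂ (fun t : ℂ => ψ (t • h)) 0 := by
    rw [← zero_smul ℂ h] at hψ
    exact hψ.comp (0 : ℂ) hline.differentiableAt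
  have h1 := logDeriv_multiplier (m := m) hn h hψt (by rwa [zero_smul]) (htend.eventually hper)
  rw [zero_smul] at h1
  have h2 := (differentiableAt_multiplier hψ m).hasFDerivAt
  have h3 := (HasFDerivAt.comp_hasDerivAt_of_eq (0 : ℂ) h2 hline (zero_smul ℂ h).symm).deriv
  have h4 : deriv (fun t : ℂ => ∏ i ∈ Finset.range m,
      pcDeriv n (t • h) ((pc n (t • h))^[i] (ψ (t • h)))) 0 = 0 := by
    refine (Filter.EventuallyEq.deriv_eq (.of_forall fun t => ?_)).trans (h3.trans hh)
    exact (hasDerivAt_iterate_pc n (t • h) m (ψ (t • h))).deriv.symm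
  rw [← h1, logDeriv_apply, h4, zero_div]

/-- For `n ≥ 2` and positive integers `m_1, …, m_{n-1}` there exist a parameter
`c* ∈ ℂ^{n-1}`, an open neighborhood `U` of `c*` and holomorphic functions
`z_1, …, z_{n-1} : U → ℂ` such that for every `c ∈ U` the point `z_j(c)` is a periodic point
of `p_c` of minimal period `m_j`, the orbits of `z_1(c), …, z_{n-1}(c)` are pairwise
disjoint, and the multiplier map `Λ(c) = ((p_c^{∘m_j})'(z_j(c)))_j` has invertible Fréchet
derivative at `c*`. -/
theorem multiplier_map_local_diffeo_at_some_point
    (n : ℕ) (hn : 2 ≤ n) (m : Fin (n - 1) → ℕ) (hm : ∀ j, 0 < m j) :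
    ∃ (cstar : Fin (n - 1) → ℂ) (U : Set (Fin (n - 1) → ℂ))
      (z : Fin (n - 1) → (Fin (n - 1) → ℂ) → ℂ),
      IsOpen U ∧ cstar ∈ U ∧
      (∀ j, DifferentiableOn ℂ (z j) U) ∧
      (∀ c ∈ U, ∀ j, Function.minimalPeriod (pc n c) (z j c) = m j) ∧
      (∀ c ∈ U, ∀ i j, i ≠ j → ∀ a b : ℕ,
        (pc n c)^[a] (z i c) ≠ (pc n c)^[b] (z j c)) ∧
      ∃ Λ' : (Fin (n - 1) → ℂ) ≃L[ℂ] (Fin (n - 1) → ℂ),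
        HasFDerivAt (fun c => fun j => deriv ((pc n c)^[m j]) (z j c))
          (Λ' : (Fin (n - 1) → ℂ) →L[ℂ] (Fin (n - 1) → ℂ)) cstar := by
  obtain ⟨w, hw, hli⟩ := exists_linearIndependent_orbitSum hn m hm
  have hwper : ∀ j, w j ^ n ^ m j = w j := fun j => by
    rw [← iterate_pow_const, ← (hw j).2]
    exact iterate_minimalPeriod
  choose z hz0 hz using fun j => exists_periodicPt_continuation hn (hm j) (hw j).1 (hwper j)
  have hdiff : ∀ j, DifferentiableAt ℂ (z j) 0 := fun j => (hz j).self_of_nhds.1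
  have hitdiff : ∀ j i, DifferentiableAt ℂ (fun c => (pc n c)^[i] (z j c)) 0 := fun j i =>
    differentiableAt_iterate_pc differentiableAt_id (hdiff j) i
  have hne : ∀ᶠ c in nhds (0 : Fin (n - 1) → ℂ), ∀ j, ∀ k ∈ Finset.Ico 1 (m j),
      (pc n c)^[k] (z j c) ≠ z j c := by
    refine Filter.eventually_all.2 fun j => (Filter.eventually_all_finset _).2 fun k hk => ?_
    refine ((hitdiff j k).continuousAt.ne_iff_eventually_ne (hdiff j).continuousAt).1 ?_
    rw [hz0, pc_zero]
    rw [Finset.mem_Ico] at hk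
    exact fun h => not_isPeriodicPt_of_pos_of_lt_minimalPeriod (by omega)
      (hk.2.trans_eq (hw j).2.symm) h
  have hdisj : ∀ᶠ c in nhds (0 : Fin (n - 1) → ℂ), ∀ i j, i ≠ j → ∀ a ∈ Finset.range (m i),
      ∀ b ∈ Finset.range (m j), (pc n c)^[a] (z i c) ≠ (pc n c)^[b] (z j c) := by
    refine Filter.eventually_all.2 fun i => Filter.eventually_all.2 fun j => ?_
    rw [Filter.eventually_imp_distrib_left]
    refine fun hij => (Filter.eventually_all_finset _).2 fun a _ =>
      (Filter.eventually_all_finset _).2 fun b _ => ?_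
    refine ((hitdiff i a).continuousAt.ne_iff_eventually_ne (hitdiff j b).continuousAt).1 ?_
    rw [hz0, hz0, pc_zero]
    intro h
    have hmem : ∀ j, w j ∈ periodicPts (fun z : ℂ => z ^ n) := fun j =>
      minimalPeriod_pos_iff_mem_periodicPts.1 ((hm j).trans_eq (hw j).2.symm)
    have hmij : m i = m j := by
      rw [← (hw i).2, ← (hw j).2, ← minimalPeriod_apply_iterate (hmem i) a, h,
        minimalPeriod_apply_iterate (hmem j)]
    refine hij (hli.injective ?_)
    rw [← orbitSum_iterate (hwper i) a, ← orbitSum_iterate (hwper j) b, h, hmij]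
  have hΛ : DifferentiableAt ℂ (fun c => fun j => deriv ((pc n c)^[m j]) (z j c)) 0 :=
    differentiableAt_pi.2 fun j => differentiableAt_multiplier (hdiff j) (m j)
  set L := fderiv ℂ (fun c => fun j => deriv ((pc n c)^[m j]) (z j c)) 0 with hL
  have hker : ∀ h, L h = 0 → h = 0 := by
    intro h hLh
    have hA : ∀ j, ∑ k : Fin (n - 1),
        (((k : ℕ) : ℂ) / n - 1) * h k * orbitSum n (m j) (w j) k = 0 := by
      intro j
      rw [← hz0 j]
      refine sum_orbitSum_eq_zero_of_fderiv_eq_zero hn (by rw [hz0]; exact (hw j).1) (hdiff j)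
        ((hz j).mono fun c hc => hc.2) h ?_
      have h1 := (hasFDerivAt_pi'.1 hΛ.hasFDerivAt j).fderiv
      rw [h1]
      exact congrFun hLh j
    have hunit : IsUnit (Matrix.of fun j => orbitSum n (m j) (w j)) :=
      Matrix.linearIndependent_rows_iff_isUnit.1 hli
    have h0 := Matrix.mulVec_injective_iff_isUnit.2 hunit
      (a₁ := fun k : Fin (n - 1) => (((k : ℕ) : ℂ) / n - 1) * h k) (a₂ := 0) (by
        rw [Matrix.mulVec_zero]
        ext j
        rw [Pi.zero_apply, ← hA j]
        simp only [Matrix.mulVec, dotProduct, Matrix.of_apply]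
        exact Finset.sum_congr rfl fun k _ => mul_comm _ _)
    funext k
    refine (mul_eq_zero.1 (congrFun h0 k)).resolve_left ?_
    have hk := k.2
    have hn0 : (n : ℂ) ≠ 0 := by exact_mod_cast (by omega : n ≠ 0)
    rw [sub_eq_zero, div_eq_one_iff_eq hn0]
    exact_mod_cast (by omega : (k : ℕ) ≠ n)
  obtain ⟨U, hU, hUo, h0U⟩ := eventually_nhds_iff.1
    ((Filter.eventually_all.2 hz).and (hne.and hdisj))
  have hperc : ∀ c ∈ U, ∀ j, minimalPeriod (pc n c) (z j c) = m j := by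
    intro c hc j
    obtain ⟨h1, h2, -⟩ := hU c hc
    have hp : IsPeriodicPt (pc n c) (m j) (z j c) := (h1 j).2
    refine le_antisymm (hp.minimalPeriod_le (hm j)) ?_
    by_contra! hlt
    exact h2 j _ (Finset.mem_Ico.2 ⟨hp.minimalPeriod_pos (hm j), hlt⟩) iterate_minimalPeriod
  refine ⟨0, U, z, hUo, h0U, fun j c hc => ((hU c hc).1 j).1.differentiableWithinAt, hperc, ?_, ?_⟩
  · intro c hc i j hij a b
    rw [← iterate_mod_minimalPeriod_eq (n := a), ← iterate_mod_minimalPeriod_eq (n := b),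
      hperc c hc, hperc c hc]
    exact (hU c hc).2.2 i j hij _ (Finset.mem_range.2 (Nat.mod_lt _ (hm i))) _
      (Finset.mem_range.2 (Nat.mod_lt _ (hm j)))
  · have hinj : Injective (L : (Fin (n - 1) → ℂ) →ₗ[ℂ] (Fin (n - 1) → ℂ)) :=
      (injective_iff_map_eq_zero _).2 hker
    refine ⟨(LinearEquiv.ofInjectiveEndo _ hinj).toContinuousLinearEquiv, ?_⟩
    convert hΛ.hasFDerivAt using 1
    ext1 h
    rfl
end

section
/- Let n ≥ 2 and identify 𝒫^n with ℂ^{n-1} via the coefficients, writing p_c(z) = z^n + c_{n-2} z^{n-2} + ⋯ + c_1 z + c_0. Suppose c* ∈ ℂ^{n-1} is such that p_{c*} has n−1 pairwise distinct fixed points z_1, …, z_{n-1} with p_{c*}'(z_j) ≠ 1 for each j (so each is a simple fixed point). Then there exist an open neighborhood U of c* and holomorphic functions ζ_1, …, ζ_{n-1} : U → ℂ with ζ_j(c*) = z_j and ζ_j(c) a fixed point of p_c for all c ∈ U, and the map φ : U → ℂ^{n-1} given by φ(c) = (p_c'(ζ_1(c)), …, p_c'(ζ_{n-1}(c))) has invertible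 (Fréchet) derivative at c*; in particular φ is a local biholomorphism at c*. -/
open Function

open Polynomial Topology

/-- If `f` is monic of degree `m + 1` with `m` prescribed simple roots `z i`, then a polynomial `q`
of degree less than `m` for which `q' f' - q f''` vanishes at every `z i` is zero. -/
theorem eq_zero_of_wronskian_derivative_eval_eq_zero {F ι : Type*} [Field F] [CharZero F]
    [Fintype ι] {z : ι → F} (hz : Function.Injective z) {f q : F[X]} (hf : f.Monic)
    (hfdeg : f.natDegree = Fintype.card ι + 1) (hroot : ∀ i, f.eval (z i) = 0)
    (hsimple : ∀ i, f.derivative.eval (z i) ≠ 0) (hq : q.degree < Fintype.card ι)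
    (h : ∀ i, q.derivative.eval (z i) * f.derivative.eval (z i)
      = q.eval (z i) * f.derivative.derivative.eval (z i)) : q = 0 := by
  classical
  set m := Fintype.card ι with hm
  set g : F[X] := Lagrange.nodal Finset.univ z with hg
  have hgm : g.Monic := Lagrange.nodal_monic
  have hgdeg : g.natDegree = m := by simp [hg, Lagrange.natDegree_nodal, hm]
  have hgz : ∀ i, g.eval (z i) = 0 := fun i =>
    Lagrange.eval_nodal_at_node (Finset.mem_univ i)
  have hdvd : ∀ p : F[X], (∀ i, p.eval (z i) = 0) → g ∣ p := fun p hp =>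
    Finset.prod_dvd_of_coprime ((pairwise_coprime_X_sub_C hz).set_pairwise _)
      fun i _ => dvd_iff_isRoot.mpr (hp i)
  obtain ⟨k, hk⟩ := hdvd f hroot
  have hkm : k.Monic := hgm.of_mul_monic_left (hk ▸ hf)
  have hkdeg : k.natDegree = 1 := by
    have := hgm.natDegree_mul hkm
    rw [← hk] at this
    omega
  set u : F[X] := Lagrange.interpolate Finset.univ z
    fun i => - q.eval (z i) / f.derivative.eval (z i) with hu
  have huz : ∀ i, u.eval (z i) = - q.eval (z i) / f.derivative.eval (z i) := fun i =>
    Lagrange.eval_interpolate_at_node _ hz.injOn (Finset.mem_univ i)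
  have hudeg : u.degree < m := by
    rw [hm, ← Finset.card_univ]
    exact Lagrange.degree_interpolate_lt _ hz.injOn
  obtain ⟨v, hv⟩ := hdvd (q + u * f.derivative) fun i => by
    have := hsimple i
    simp only [eval_add, eval_mul, huz]
    field_simp
    ring
  by_cases hu0 : u = 0
  · refine eq_zero_of_degree_lt_of_eval_index_eq_zero Finset.univ hz.injOn
      (by simpa [hm] using hq) fun i _ => ?_
    have := huz i
    rw [hu0, eval_zero, eq_comm, div_eq_zero_iff, neg_eq_zero] at this
    exact this.resolve_right (hsimple i)
  exfalso
  have hud : u.natDegree < m := (natDegree_lt_iff_degree_lt hu0).mpr hudeg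
  have hqd : q.natDegree < m := by
    by_cases hq0 : q = 0
    · simp only [hq0, natDegree_zero]; omega
    · exact (natDegree_lt_iff_degree_lt hq0).mpr hq
  have hfd : f.derivative.natDegree ≤ m := by
    have := natDegree_derivative_le f
    omega
  have hud' := natDegree_derivative_le u
  have hvdeg : v.natDegree < m := by
    by_cases hv0 : v = 0
    · simp only [hv0, natDegree_zero]; omega
    have h1 := hgm.natDegree_mul' hv0
    rw [← hv] at h1
    have h2 := natDegree_add_le q (u * f.derivative)
    have h3 := natDegree_mul_le (p := u) (q := f.derivative)
    grind
  have hvk : v - k * u.derivative = 0 := by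
    refine eq_zero_of_natDegree_lt_card_of_eval_eq_zero _ hz (fun i => ?_) ?_
    · have hf1 : f.derivative.eval (z i) = g.derivative.eval (z i) * k.eval (z i) := by
        simp [hk, derivative_mul, hgz]
      have h1 := congrArg (fun p => p.derivative.eval (z i)) hv
      simp only [derivative_add, derivative_mul, eval_add, eval_mul, hgz, huz] at h1
      have h0 := hsimple i
      have hg0 : g.derivative.eval (z i) ≠ 0 := fun h' => h0 (by rw [hf1, h', zero_mul])
      have hi := h i
      apply mul_left_cancel₀ hg0
      simp only [eval_sub, eval_mul, mul_zero]
      have h2 : eval (z i) q.derivative =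
          eval (z i) q * eval (z i) f.derivative.derivative / eval (z i) f.derivative := by
        rw [eq_div_iff h0, hi]
      rw [h2] at h1
      have h3 : eval (z i) u.derivative * eval (z i) f.derivative
          = eval (z i) g.derivative * eval (z i) v := by
        linear_combination h1
      rw [hf1] at h3
      linear_combination -h3
    · have h1 := natDegree_sub_le v (k * u.derivative)
      have h2 := natDegree_mul_le (p := k) (q := u.derivative)
      by_cases hd : u.natDegree = 0
      · have : u.derivative = 0 := derivative_of_natDegree_zero hd
        simpa [this] using hvdeg
      · rw [hkdeg] at h2
        grind
  have hqe : q + u * f.derivative = u.derivative * f := by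
    rw [hv, sub_eq_zero.mp hvk, hk]; ring
  have hc := congrArg (fun p => p.coeff (u.natDegree + m)) hqe
  have hq1 : q.coeff (u.natDegree + m) = 0 := coeff_eq_zero_of_natDegree_lt (by omega)
  have hc1 : (u * f.derivative).coeff (u.natDegree + m) = u.leadingCoeff * (m + 1) := by
    rw [coeff_mul_add_eq_of_natDegree_le le_rfl hfd, coeff_derivative, ← hfdeg, hf.coeff_natDegree,
      coeff_natDegree, one_mul]
  have hc2 : (u.derivative * f).coeff (u.natDegree + m) = u.leadingCoeff * u.natDegree := by
    by_cases hd : u.natDegree = 0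
    · simp [derivative_of_natDegree_zero hd, hd]
    · obtain ⟨d, hd⟩ := Nat.exists_eq_succ_of_ne_zero hd
      have : u.natDegree + m = d + (m + 1) := by omega
      rw [this, coeff_mul_add_eq_of_natDegree_le (by omega) hfdeg.le, coeff_derivative, ← hfdeg,
        hf.coeff_natDegree, mul_one, leadingCoeff, hd]
      push_cast
      rfl
  simp only [coeff_add, hq1, hc1, hc2, zero_add] at hc
  have := mul_left_cancel₀ (leadingCoeff_ne_zero.mpr hu0) hc
  norm_cast at this
  omega

/-- A scalar implicit function theorem with differentiability on a neighbourhood. -/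
theorem exists_implicitFunction_of_contDiffAt {E : Type*} [NormedAddCommGroup E]
    [NormedSpace ℂ E] [CompleteSpace E] {f : E × ℂ → ℂ} {a : E} {w d : ℂ}
    (hf : ContDiffAt ℂ 1 f (a, w)) (hd : HasDerivAt (fun y => f (a, y)) d w) (hd0 : d ≠ 0) :
    ∃ ψ : E → ℂ, ψ a = w ∧ (∀ᶠ x in 𝓝 a, f (x, ψ x) = f (a, w)) ∧
      ∀ᶠ x in 𝓝 a, DifferentiableAt ℂ ψ x := by
  have h1 : HasFDerivAt (fun y => f (a, y)) (fderiv ℂ f (a, w) ∘L .inr ℂ E ℂ) w :=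
    (hf.differentiableAt one_ne_zero).hasFDerivAt.comp w (hasFDerivAt_prodMk_right a w)
  have hinv : (fderiv ℂ f (a, w) ∘L .inr ℂ E ℂ).IsInvertible :=
    ⟨.unitsEquivAut ℂ (.mk0 d hd0), (hd.hasFDerivAt_equiv hd0).unique h1⟩
  refine ⟨hf.implicitFunction one_ne_zero hinv, hf.implicitFunction_apply_self _ hinv,
    hf.eventually_apply_implicitFunction _ hinv, ?_⟩
  filter_upwards [(hf.contDiffAt_implicitFunction one_ne_zero hinv).eventually (by simp)]
    with x hx using hx.differentiableAt one_ne_zero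

/-- The affine family of polynomials `A + ∑ i, c i • b i`. -/
noncomputable def affineFamily {ι : Type*} [Fintype ι] (A : ℂ[X]) (b : ι → ℂ[X]) (c : ι → ℂ) :
    ℂ[X] :=
  A + ∑ i, C (c i) * b i

section affineFamily

variable {ι : Type*} [Fintype ι] (A : ℂ[X]) (b : ι → ℂ[X])

theorem eval_affineFamily (c : ι → ℂ) (w : ℂ) :
    (affineFamily A b c).eval w = A.eval w + ∑ i, c i * (b i).eval w := by
  simp [affineFamily, eval_finsetSum]

theorem derivative_affineFamily (c : ι → ℂ) :
    derivative (affineFamily A b c) =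
      affineFamily (derivative A) (fun i => derivative (b i)) c := by
  simp [affineFamily]

theorem contDiff_eval_affineFamily :
    ContDiff ℂ 1 fun x : (ι → ℂ) × ℂ => (affineFamily A b x.1).eval x.2 := by
  simp only [eval_affineFamily]
  have h (p : ℂ[X]) : ContDiff ℂ 1 fun x : (ι → ℂ) × ℂ => p.eval x.2 := by
    have hp : ContDiff ℂ 1 fun w : ℂ => p.eval w := by
      simpa using p.contDiff_aeval (R := ℂ) (𝕜 := ℂ) 1
    exact hp.comp contDiff_snd
  exact (h A).add (ContDiff.sum fun i _ =>
    (contDiff_apply ℂ ℂ i |>.comp contDiff_fst).mul (h (b i)))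

/-- The derivative of `c ↦ (affineFamily A b c).eval (ζ c)` in the direction `v`. -/
theorem fderiv_eval_affineFamily {ζ : (ι → ℂ) → ℂ} {c : ι → ℂ} (hζ : DifferentiableAt ℂ ζ c)
    (v : ι → ℂ) :
    fderiv ℂ (fun x => (affineFamily A b x).eval (ζ x)) c v =
      (affineFamily 0 b v).eval (ζ c) +
        (derivative (affineFamily A b c)).eval (ζ c) * fderiv ℂ ζ c v := by
  have h (p : ℂ[X]) : HasFDerivAt (fun x => p.eval (ζ x))
      ((derivative p).eval (ζ c) • fderiv ℂ ζ c) c :=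
    (p.hasDerivAt (ζ c)).comp_hasFDerivAt c hζ.hasFDerivAt
  have h2 := (h A).fun_add (HasFDerivAt.fun_sum (u := Finset.univ)
    fun i _ => (hasFDerivAt_apply (𝕜 := ℂ) i c).fun_mul (h (b i)))
  simp only [eval_affineFamily]
  rw [h2.fderiv]
  simp [derivative_affineFamily, eval_affineFamily, Finset.sum_add_distrib, add_mul,
    Finset.sum_mul, mul_assoc]
  simp only [mul_comm]
  ring

end affineFamily

theorem degree_affineFamily_zero_lt {m : ℕ} (v : Fin m → ℂ) :
    (affineFamily 0 (fun i : Fin m => X ^ (i : ℕ)) v).degree < m := by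
  rw [affineFamily, zero_add]
  refine (degree_sum_le _ _).trans_lt ((Finset.sup_lt_iff (WithBot.bot_lt_coe m)).mpr fun i _ => ?_)
  exact (degree_C_mul_X_pow_le _ _).trans_lt (Nat.cast_lt.mpr i.2)

theorem eq_zero_of_affineFamily_zero_eq_zero {m : ℕ} {v : Fin m → ℂ}
    (h : affineFamily 0 (fun i : Fin m => X ^ (i : ℕ)) v = 0) : v = 0 := by
  ext i
  have := congrArg (fun p => p.coeff i) h
  simpa [affineFamily, coeff_C_mul, coeff_X_pow, Fin.val_inj] using this

/-- If `p_{c*}` has `n-1` pairwise distinct fixed points `z_j`, each simple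
(multiplier `≠ 1`), then the fixed points continue holomorphically to a neighborhood `U` of
`c*` and the fixed-point multiplier map `φ(c) = (p_c'(ζ_j(c)))_j` has invertible Fréchet
derivative at `c*`. -/
theorem fixed_point_multiplier_map_local_diffeo
    (n : ℕ) (hn : 2 ≤ n) (cstar : Fin (n - 1) → ℂ) (z : Fin (n - 1) → ℂ)
    (hz : Function.Injective z)
    (hfix : ∀ j, pc n cstar (z j) = z j)
    (hsimple : ∀ j, deriv (pc n cstar) (z j) ≠ 1) :
    ∃ (U : Set (Fin (n - 1) → ℂ)) (ζ : Fin (n - 1) → (Fin (n - 1) → ℂ) → ℂ),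
      IsOpen U ∧ cstar ∈ U ∧
      (∀ j, DifferentiableOn ℂ (ζ j) U) ∧
      (∀ j, ζ j cstar = z j) ∧
      (∀ c ∈ U, ∀ j, pc n c (ζ j c) = ζ j c) ∧
      ∃ φ' : (Fin (n - 1) → ℂ) ≃L[ℂ] (Fin (n - 1) → ℂ),
        HasFDerivAt (fun c => fun j => deriv (pc n c) (ζ j c))
          (φ' : (Fin (n - 1) → ℂ) →L[ℂ] (Fin (n - 1) → ℂ)) cstar := by
  set b : Fin (n - 1) → ℂ[X] := fun i => X ^ (i : ℕ) with hb
  -- `P c = p_c - z`, whose roots are the fixed points of `p_c`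
  set P : (Fin (n - 1) → ℂ) → ℂ[X] := affineFamily (X ^ n - X) b with hP
  have hpc (c w) : pc n c w = (P c).eval w + w := by
    simp [pc, hP, eval_affineFamily, hb]
    ring
  have hdpc (c w) : deriv (pc n c) w = (derivative (P c)).eval w + 1 := by
    rw [funext (hpc c)]
    exact (((P c).hasDerivAt w).add (hasDerivAt_id w)).deriv
  have hroot (j) : (P cstar).eval (z j) = 0 := by simpa [hpc] using hfix j
  have hP' (j) : (derivative (P cstar)).eval (z j) ≠ 0 := by simpa [hdpc] using hsimple j
  choose ζ hζz hζroot hζdiff using fun j =>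
    exists_implicitFunction_of_contDiffAt (a := cstar)
      (contDiff_eval_affineFamily (X ^ n - X) b).contDiffAt ((P cstar).hasDerivAt (z j)) (hP' j)
  obtain ⟨U, hU, hUo, hcU⟩ := eventually_nhds_iff.mp
    ((Filter.eventually_all.mpr hζroot).and (Filter.eventually_all.mpr hζdiff))
  refine ⟨U, ζ, hUo, hcU, fun j c hc => ((hU c hc).2 j).differentiableWithinAt, hζz,
    fun c hc j => ?_, ?_⟩
  · rw [hpc, hP, (hU c hc).1 j]
    simpa using hroot j
  have hd (j) : DifferentiableAt ℂ (ζ j) cstar := (hU cstar hcU).2 j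
  have hφ : DifferentiableAt ℂ (fun c => fun j => deriv (pc n c) (ζ j c)) cstar := by
    refine differentiableAt_pi.mpr fun j => ?_
    simp only [hdpc, hP, derivative_affineFamily]
    exact (((contDiff_eval_affineFamily _ _).differentiable one_ne_zero _).comp cstar
      (differentiableAt_id.prodMk (hd j))).add_const _
  set L := fderiv ℂ (fun c => fun j => deriv (pc n c) (ζ j c)) cstar with hL
  have hinj : Function.Injective L := by
    refine (injective_iff_map_eq_zero L).mpr fun v hv => ?_
    refine eq_zero_of_affineFamily_zero_eq_zero ?_
    have hdeg : (P cstar - X ^ n).degree < (n : WithBot ℕ) := by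
      have : P cstar - X ^ n = affineFamily 0 b cstar - X := by
        simp [hP, affineFamily]; ring
      rw [this]
      refine (degree_sub_le _ _).trans_lt (max_lt ?_ ?_)
      · exact (degree_affineFamily_zero_lt cstar).trans_le (by exact_mod_cast Nat.sub_le n 1)
      · rw [degree_X]; exact_mod_cast hn
    have hPe : P cstar = X ^ n + (P cstar - X ^ n) := by ring
    refine eq_zero_of_wronskian_derivative_eval_eq_zero hz (f := P cstar)
      (hPe ▸ monic_X_pow_add hdeg) ?_ hroot hP' ?_ fun j => ?_
    · rw [hPe, natDegree_add_eq_left_of_degree_lt (by simpa using hdeg), natDegree_X_pow,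
        Fintype.card_fin]; omega
    · simpa using degree_affineFamily_zero_lt v
    · have h1 : fderiv ℂ (fun c => (P c).eval (ζ j c)) cstar v = 0 := by
        rw [Filter.EventuallyEq.fderiv_eq (f := fun _ => (P cstar).eval (z j)) (hζroot j)]
        simp
      have h2 : fderiv ℂ (fun c => (derivative (P c)).eval (ζ j c)) cstar v = 0 := by
        have := congrFun hv j
        rw [hL, fderiv_pi fun i => differentiableAt_pi.mp hφ i] at this
        simpa [hdpc] using this
      rw [hP, fderiv_eval_affineFamily _ _ (hd j), hζz] at h1
      simp only [hP, derivative_affineFamily] at h2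
      rw [fderiv_eval_affineFamily _ _ (hd j), hζz] at h2
      simp only [hP, derivative_affineFamily, derivative_zero] at h1 ⊢
      rw [derivative_affineFamily] at h2
      linear_combination (eval (z j) (affineFamily (derivative (X ^ n - X))
        (fun i => derivative (b i)) cstar)) * h2 - (eval (z j) (affineFamily
        (derivative (derivative (X ^ n - X))) (fun i => derivative (derivative (b i))) cstar)) * h1
  let e := (LinearEquiv.ofInjectiveEndo (L : (Fin (n - 1) → ℂ) →ₗ[ℂ] (Fin (n - 1) → ℂ))
    hinj).toContinuousLinearEquiv
  refine ⟨e, ?_⟩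
  have : (e : (Fin (n - 1) → ℂ) →L[ℂ] (Fin (n - 1) → ℂ)) = L := by ext; rfl
  rw [this]
  exact hφ.hasFDerivAt
end

section
/- Let n ≥ 2. There exists a nonzero polynomial Q ∈ ℂ[X_1, …, X_{n-1}] such that for every tuple (λ_1, …, λ_{n-1}) ∈ ℂ^{n-1} with Q(λ_1, …, λ_{n-1}) ≠ 0, there exist a monic centered polynomial p of degree n over ℂ and pairwise distinct fixed points z_1, …, z_{n-1} of p with p'(z_j) = λ_j for every j. In other words, the fixed-point multiplier map attains all values in ℂ^{n-1} outside a proper algebraic subset (a subset of complex codimension 1). -/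
/-- Over an algebraically closed field, fewer polynomials vanishing at the origin than variables
have a common zero other than the origin. -/
theorem MvPolynomial.exists_ne_zero_common_zero {k σ ι : Type*} [Field k] [IsAlgClosed k]
    [Fintype σ] [Fintype ι] (hcard : Fintype.card ι < Fintype.card σ)
    (f : ι → MvPolynomial σ k) (hf : ∀ i, MvPolynomial.eval 0 (f i) = 0) :
    ∃ y : σ → k, y ≠ 0 ∧ ∀ i, MvPolynomial.eval y (f i) = 0 := by
  have hdim : ringKrullDim (MvPolynomial σ k) = Fintype.card σ := by
    rw [MvPolynomial.ringKrullDim_of_isNoetherianRing, ringKrullDim_eq_zero_of_field]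
    simp
  have : FiniteRingKrullDim (MvPolynomial σ k) := by
    rw [finiteRingKrullDim_iff_ne_bot_and_top, hdim]
    exact ⟨WithBot.coe_ne_bot, WithBot.coe_injective.ne (ENat.natCast_ne_top _)⟩
  obtain ⟨p, hpmax, hp⟩ := Ideal.exists_isMaximal_height (R := MvPolynomial σ k)
  obtain ⟨x, hx⟩ := MvPolynomial.isMaximal_iff_eq_vanishingIdeal_singleton.mp hpmax
  let g : ι → MvPolynomial σ k := fun i =>
    MvPolynomial.aeval (fun j => MvPolynomial.X j - MvPolynomial.C (x j)) (f i)
  have hg (y : σ → k) (i : ι) : MvPolynomial.eval y (g i) = MvPolynomial.eval (y - x) (f i) := by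
    rw [← MvPolynomial.aeval_eq_eval, ← MvPolynomial.aeval_eq_eval, MvPolynomial.comp_aeval_apply]
    simp [Pi.sub_def]
  by_contra! hcon
  let I := Ideal.span (Set.range g)
  have hlocus : MvPolynomial.zeroLocus k I = {x} := by
    ext y
    rw [MvPolynomial.zeroLocus_span]
    simp only [Set.mem_ofPred_eq, Set.forall_mem_range, Set.mem_singleton_iff]
    constructor
    · intro h
      by_contra hne
      obtain ⟨i, hi⟩ := hcon (y - x) (sub_ne_zero.mpr hne)
      exact hi (by rw [← hg, ← MvPolynomial.coe_aeval_eq_eval]; exact h i)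
    · rintro rfl i
      have := hg y i
      rw [sub_self, hf, ← MvPolynomial.coe_aeval_eq_eval] at this
      exact this
  have hrad : I.radical = p := by
    rw [← MvPolynomial.vanishingIdeal_zeroLocus_eq_radical (K := k), hlocus, hx]
  have hmin : p ∈ I.minimalPrimes := by
    rw [← Ideal.radical_minimalPrimes, hrad, Ideal.minimalPrimes_eq_subsingleton_self]
    rfl
  have hle : p.height ≤ (Fintype.card ι : ℕ∞) := by
    refine (Ideal.height_le_card_of_mem_minimalPrimes_span (Set.finite_range g) hmin).trans ?_
    rw [← Nat.card_coe_set_eq, ← Nat.card_eq_fintype_card]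
    exact_mod_cast Finite.card_range_le g
  rw [hdim] at hp
  have hp' : p.height = (Fintype.card σ : ℕ∞) := by exact_mod_cast hp
  rw [hp'] at hle
  exact absurd hcard (not_lt.mpr (by exact_mod_cast hle))

/-- A weighted sum of the values of a polynomial depends only on its leading term as soon as the
weighted power sums of smaller positive degree vanish. -/
theorem Polynomial.sum_mul_eval_eq_of_power_sums_eq_zero {ι R : Type*} [Fintype ι] [CommRing R]
    {r y : ι → R} {m : ℕ} (hy : ∀ k, 0 < k → k < m → ∑ j, r j * y j ^ k = 0)
    {P : Polynomial R} (hP : P.natDegree ≤ m) (hP0 : P.coeff 0 = 0) :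
    ∑ j, r j * P.eval (y j) = P.coeff m * ∑ j, r j * y j ^ m := by
  simp_rw [Polynomial.eval_eq_sum_range' (Nat.lt_succ_of_le hP), Finset.mul_sum]
  rw [Finset.sum_comm, Finset.sum_range_succ, Finset.sum_eq_zero, zero_add]
  · exact Finset.sum_congr rfl fun j _ => by ring
  · intro k hk
    rcases Nat.eq_zero_or_pos k with rfl | hk0
    · simp [hP0]
    · have := hy k hk0 (Finset.mem_range.mp hk)
      calc ∑ j, r j * (P.coeff k * y j ^ k) = P.coeff k * ∑ j, r j * y j ^ k := by
            rw [Finset.mul_sum]; exact Finset.sum_congr rfl fun j _ => by ring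
        _ = 0 := by rw [this, mul_zero]

/-- If no nonempty subfamily of the weights has sum zero, a nonzero vector all of whose weighted
power sums of positive degree less than the number of entries vanish has distinct nonzero
entries. -/
theorem injective_and_ne_zero_of_power_sums_eq_zero {ι K : Type*} [Fintype ι] [Field K]
    {r y : ι → K} (hr : ∀ S : Finset ι, S.Nonempty → ∑ j ∈ S, r j ≠ 0) (hy0 : y ≠ 0)
    (hy : ∀ k, 0 < k → k < Fintype.card ι → ∑ j, r j * y j ^ k = 0) :
    Function.Injective y ∧ ∀ j, y j ≠ 0 := by
  classical
  let W : Finset K := (Finset.univ.image y).erase 0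
  obtain ⟨j₀, hj₀⟩ : ∃ j, y j ≠ 0 := Function.ne_iff.mp hy0
  have hw : y j₀ ∈ W := by simp [W, hj₀]
  have hcard : Fintype.card ι ≤ W.card := by
    by_contra! hlt
    let P : Polynomial K := Polynomial.X * ∏ v ∈ W.erase (y j₀), (Polynomial.X - Polynomial.C v)
    have hdeg : P.natDegree < Fintype.card ι := by
      refine lt_of_le_of_lt ?_ hlt
      refine Polynomial.natDegree_mul_le.trans ?_
      rw [Polynomial.natDegree_X, Polynomial.natDegree_finsetProd_X_sub_C_eq_card,
        Finset.card_erase_of_mem hw]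
      have := Finset.card_pos.mpr ⟨_, hw⟩
      omega
    have hsum := Polynomial.sum_mul_eval_eq_of_power_sums_eq_zero hy hdeg.le (by simp [P])
    rw [Polynomial.coeff_eq_zero_of_natDegree_lt hdeg, zero_mul] at hsum
    have heval (v : K) : P.eval v = v * ∏ u ∈ W.erase (y j₀), (v - u) := by
      simp [P, Polynomial.eval_prod]
    have hzero (j : ι) (hj : y j ≠ y j₀) : P.eval (y j) = 0 := by
      rw [heval]
      by_cases h0 : y j = 0
      · rw [h0, zero_mul]
      · rw [Finset.prod_eq_zero (i := y j) (by simp [W, h0, hj]) (sub_self _), mul_zero]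
    have hne : P.eval (y j₀) ≠ 0 := by
      rw [heval]
      exact mul_ne_zero hj₀ (Finset.prod_ne_zero_iff.mpr fun u hu =>
        sub_ne_zero.mpr (Finset.ne_of_mem_erase hu).symm)
    refine mul_ne_zero (hr {j | y j = y j₀} ⟨j₀, by simp⟩) hne ?_
    rw [Finset.sum_mul, ← hsum, Finset.sum_filter]
    refine Finset.sum_congr rfl fun j _ => ?_
    split_ifs with h
    · rw [h]
    · rw [hzero j h, mul_zero]
  have himage : (Finset.univ.image y).card ≤ Fintype.card ι := Finset.card_image_le
  have h0 : (0 : K) ∉ Finset.univ.image y := fun h => by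
    have : W.card < (Finset.univ.image y).card := Finset.card_erase_lt_of_mem h
    omega
  have hWle : W.card ≤ (Finset.univ.image y).card := Finset.card_le_card (Finset.erase_subset _ _)
  refine ⟨?_, fun j hj => h0 (Finset.mem_image.mpr ⟨j, Finset.mem_univ j, hj⟩)⟩
  have : Set.InjOn y (Finset.univ : Finset ι) := by
    rw [← Finset.card_image_iff, Finset.card_univ]
    omega
  simpa using this

/-- If no nonempty subfamily of the weights has sum zero, there are distinct nonzero points at
which the polynomial vanishing exactly there and at the origin has the inverse weights as
derivatives. -/
theorem exists_injective_mul_prod_sub_eq_one {ι K : Type*} [Fintype ι] [DecidableEq ι] [Nonempty ι]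
    [Field K] [IsAlgClosed K] {r : ι → K}
    (hr : ∀ S : Finset ι, S.Nonempty → ∑ j ∈ S, r j ≠ 0) :
    ∃ z : ι → K, Function.Injective z ∧
      ∀ j, r j * (z j * ∏ i ∈ Finset.univ.erase j, (z j - z i)) = 1 := by
  have hm : 0 < Fintype.card ι := Fintype.card_pos
  obtain ⟨y, hy0, hy⟩ := MvPolynomial.exists_ne_zero_common_zero
    (ι := Fin (Fintype.card ι - 1)) (σ := ι) (by simpa using hm)
    (fun k => ∑ j, MvPolynomial.C (r j) * MvPolynomial.X j ^ ((k : ℕ) + 1)) (by simp)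
  have hpow (k : ℕ) (hk0 : 0 < k) (hk : k < Fintype.card ι) : ∑ j, r j * y j ^ k = 0 := by
    have := hy ⟨k - 1, by omega⟩
    simpa [Nat.sub_add_cancel hk0] using this
  obtain ⟨hinj, hne⟩ := injective_and_ne_zero_of_power_sums_eq_zero hr hy0 hpow
  let s := ∑ j, r j * y j ^ Fintype.card ι
  have hs (j : ι) : r j * (y j * ∏ i ∈ Finset.univ.erase j, (y j - y i)) = s := by
    let P : Polynomial K :=
      Polynomial.X * ∏ i ∈ Finset.univ.erase j, (Polynomial.X - Polynomial.C (y i))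
    have hmonic : P.Monic := Polynomial.monic_X.mul (Polynomial.monic_prod_X_sub_C _ _)
    have hdeg : P.natDegree = Fintype.card ι := by
      rw [Polynomial.monic_X.natDegree_mul (Polynomial.monic_prod_X_sub_C _ _),
        Polynomial.natDegree_X, Polynomial.natDegree_finsetProd_X_sub_C_eq_card,
        Finset.card_erase_of_mem (Finset.mem_univ j), Finset.card_univ]
      omega
    have hsum := Polynomial.sum_mul_eval_eq_of_power_sums_eq_zero hpow hdeg.le (by simp [P])
    rw [← hdeg, hmonic.coeff_natDegree, one_mul, hdeg, Finset.sum_eq_single j] at hsum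
    · rw [show s = _ from hsum.symm]
      simp [P, Polynomial.eval_prod]
    · intro i _ hij
      have : P.eval (y i) = 0 := by
        simp only [P, Polynomial.eval_mul, Polynomial.eval_prod]
        rw [Finset.prod_eq_zero (i := i) (by simp [hij]) (by simp), mul_zero]
      rw [this, mul_zero]
    · simp
  have hs0 : s ≠ 0 := by
    let j := Classical.arbitrary ι
    rw [← hs j]
    refine mul_ne_zero (by simpa using hr {j} (by simp)) (mul_ne_zero (hne j) ?_)
    exact Finset.prod_ne_zero_iff.mpr fun i hi =>
      sub_ne_zero.mpr fun h => Finset.ne_of_mem_erase hi (hinj h).symm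
  obtain ⟨c, hc⟩ := IsAlgClosed.exists_pow_nat_eq s⁻¹ hm
  have hc0 : c ≠ 0 := by
    rintro rfl
    rw [zero_pow hm.ne'] at hc
    exact inv_ne_zero hs0 hc.symm
  refine ⟨fun j => c * y j, fun i j h => hinj (mul_left_cancel₀ hc0 h), fun j => ?_⟩
  simp only [← mul_sub]
  rw [Finset.prod_mul_distrib, Finset.prod_const, Finset.card_erase_of_mem (Finset.mem_univ j),
    Finset.card_univ]
  calc _ = c ^ (Fintype.card ι - 1 + 1) *
        (r j * (y j * ∏ i ∈ Finset.univ.erase j, (y j - y i))) := by ring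
    _ = 1 := by rw [Nat.sub_add_cancel hm, hs, hc, inv_mul_cancel₀ hs0]

/-- Conjugating by a suitable translation removes the subleading coefficient. -/
theorem Polynomial.Monic.exists_coeff_comp_X_add_C_sub_C_eq_zero {K : Type*} [Field K] [CharZero K]
    {p : Polynomial K} (hp : p.Monic) (hdeg : 2 ≤ p.natDegree) :
    ∃ c : K, (p.comp (X + C c) - C c).Monic ∧
      (p.comp (X + C c) - C c).natDegree = p.natDegree ∧
      (p.comp (X + C c) - C c).coeff (p.natDegree - 1) = 0 := by
  obtain ⟨m, hm⟩ : ∃ m, p.natDegree = m + 1 := ⟨p.natDegree - 1, by omega⟩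
  have hm0 : m ≠ 0 := by omega
  refine ⟨-p.coeff m / (m + 1), ?_⟩
  set c := -p.coeff m / (m + 1 : K) with hc
  have hnat : (p.comp (X + C c)).natDegree = p.natDegree := by
    rw [natDegree_comp, natDegree_X_add_C, mul_one]
  have hmon : (p.comp (X + C c)).Monic := hp.comp_X_add_C c
  refine ⟨?_, ?_, ?_⟩
  · refine hmon.sub_of_left (lt_of_le_of_lt degree_C_le ?_)
    rw [← natDegree_pos_iff_degree_pos, hnat]
    omega
  · rw [natDegree_sub_C, hnat]
  · rw [hm, Nat.add_sub_cancel, coeff_sub, coeff_C_of_ne_zero hm0, sub_zero, ← taylor_apply,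
      taylor_coeff, eval_eq_sum_range' (n := 2)]
    · have h1 : (m : K) + 1 ≠ 0 := by exact_mod_cast m.succ_ne_zero
      have h2 : p.coeff (1 + m) = 1 := by rw [add_comm, ← hm]; exact hp.coeff_natDegree
      simp [Finset.sum_range_succ, hasseDeriv_coeff, hc, add_comm 1 m]
      rw [add_comm m 1, h2]
      field_simp
      ring
    · have := natDegree_hasseDeriv_le p m
      omega

/-- For `n ≥ 2`, the fixed-point multiplier map attains all values in `ℂ^{n-1}`
outside a proper algebraic subset: there is a nonzero polynomial `Q ∈ ℂ[X_1,…,X_{n-1}]` such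
that every tuple `(λ_1, …, λ_{n-1})` with `Q(λ) ≠ 0` is realized as the tuple of multipliers
at `n-1` pairwise distinct fixed points of some monic centered polynomial of degree `n`. -/
theorem fixed_point_multipliers_attain_generic_values (n : ℕ) (hn : 2 ≤ n) :
    ∃ Q : MvPolynomial (Fin (n - 1)) ℂ, Q ≠ 0 ∧
      ∀ lam : Fin (n - 1) → ℂ, MvPolynomial.eval lam Q ≠ 0 →
        ∃ (p : Polynomial ℂ) (z : Fin (n - 1) → ℂ),
          p.Monic ∧ p.natDegree = n ∧ p.coeff (n - 1) = 0 ∧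
          Function.Injective z ∧
          (∀ j, p.eval (z j) = z j) ∧
          (∀ j, p.derivative.eval (z j) = lam j) := by
  let Q : MvPolynomial (Fin (n - 1)) ℂ :=
    (∏ j, (MvPolynomial.X j - 1)) *
      ∏ S : Finset (Fin (n - 1)) with S.Nonempty,
        ∑ j ∈ S, ∏ i ∈ S.erase j, (MvPolynomial.X i - 1)
  have hQ (lam : Fin (n - 1) → ℂ) : MvPolynomial.eval lam Q = (∏ j, (lam j - 1)) *
      ∏ S : Finset (Fin (n - 1)) with S.Nonempty, ∑ j ∈ S, ∏ i ∈ S.erase j, (lam i - 1) := by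
    simp [Q]
  refine ⟨Q, ?_, fun lam hlam => ?_⟩
  · intro h
    have := hQ (fun _ => 2)
    rw [h, map_zero, eq_comm] at this
    revert this
    norm_num
    rw [Finset.prod_eq_zero_iff]
    simp [Finset.nonempty_iff_ne_empty]
  · rw [hQ, mul_ne_zero_iff, Finset.prod_ne_zero_iff, Finset.prod_ne_zero_iff] at hlam
    obtain ⟨hne, hsub⟩ := hlam
    have hr (S : Finset (Fin (n - 1))) (hS : S.Nonempty) : ∑ j ∈ S, (lam j - 1)⁻¹ ≠ 0 := by
      intro h
      apply hsub S (by simpa using hS)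
      rw [← mul_zero (∏ i ∈ S, (lam i - 1)), ← h, Finset.mul_sum]
      refine Finset.sum_congr rfl fun j hj => ?_
      rw [← Finset.prod_erase_mul S _ hj, mul_inv_cancel_right₀ (hne j (Finset.mem_univ j))]
    have : Nonempty (Fin (n - 1)) := ⟨⟨0, by omega⟩⟩
    obtain ⟨z, hinj, hz⟩ := exists_injective_mul_prod_sub_eq_one hr
    let q : Polynomial ℂ := Polynomial.X * ∏ i, (Polynomial.X - Polynomial.C (z i))
    have hqm : q.Monic := Polynomial.monic_X.mul (Polynomial.monic_prod_X_sub_C _ _)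
    have hqd : q.natDegree = n := by
      rw [Polynomial.monic_X.natDegree_mul (Polynomial.monic_prod_X_sub_C _ _),
        Polynomial.natDegree_X, Polynomial.natDegree_finsetProd_X_sub_C_eq_card,
        Finset.card_univ, Fintype.card_fin]
      omega
    have hlt : (Polynomial.X : Polynomial ℂ).degree < q.degree := by
      rw [Polynomial.degree_X, Polynomial.degree_eq_natDegree hqm.ne_zero, hqd]
      exact_mod_cast hn
    have hpm : (q + Polynomial.X).Monic := hqm.add_of_left hlt
    have hpd : (q + Polynomial.X).natDegree = n := by
      rw [Polynomial.natDegree_eq_of_degree_eq (Polynomial.degree_add_eq_left_of_degree_lt hlt),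
        hqd]
    have hqz (j : Fin (n - 1)) : q.eval (z j) = 0 := by
      simp only [q, Polynomial.eval_mul, Polynomial.eval_prod]
      rw [Finset.prod_eq_zero (Finset.mem_univ j) (by simp), mul_zero]
    have hqz' (j : Fin (n - 1)) : q.derivative.eval (z j) = lam j - 1 := by
      have hsplit : q = (Polynomial.X - Polynomial.C (z j)) * (Polynomial.X *
          ∏ i ∈ Finset.univ.erase j, (Polynomial.X - Polynomial.C (z i))) := by
        simp only [q]
        rw [← Finset.mul_prod_erase _ _ (Finset.mem_univ j)]
        ring
      have h := hz j
      rw [inv_mul_eq_one₀ (hne j (Finset.mem_univ j))] at h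
      rw [hsplit, Polynomial.derivative_mul]
      simp [Polynomial.eval_prod, h]
    obtain ⟨c, h1, h2, h3⟩ := hpm.exists_coeff_comp_X_add_C_sub_C_eq_zero (hn.trans_eq hpd.symm)
    rw [hpd] at h2 h3
    refine ⟨_, fun j => z j - c, h1, h2, h3, fun i j h => hinj (sub_left_injective h),
      fun j => ?_, fun j => ?_⟩
    · simp [hqz]
    · simp [Polynomial.derivative_comp, hqz']
end
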